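/- arXiv:1602.03039 — 2 statements merged into one kernel-verified Lean document; each statement's English description precedes it below -/
import Mathlib

section
/- Let Q be a Dynkin quiver, M a representation of dimension vector d, and N a representation of dimension vector e. The stratum S_{[N]} of the quiver Grassmannian Gr_e(M) consisting of subrepresentations isomorphic to N is a locally closed subset of dimension dim Hom_Q(N,M) − dim Hom_Q(N,N). -/
/-!
STATEMENT 6: Let Q be a Dynkin quiver over ℂ, M a representation of dimension vector
d, and N a representation of dimension vector e.  The stratum `S_{[N]}` of the quiver
Grassmannian `Gr_e(M)` consisting of subrepresentations isomorphic to N is a locally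
closed subset of dimension `dim Hom_Q(N,M) − dim Hom_Q(N,N)`.

The quiver Grassmannian carries its Zariski topology (geometric quotient); the
dimension equality is stated additively in `WithBot ℕ∞`; a quiver is Dynkin iff its
Tits form is positive definite.  The stratum is assumed nonempty (i.e. the formula is
asserted for the strata occurring in the stratification).
-/

noncomputable section
open Matrix

variable {V A : Type}

/-- A complex representation of the quiver `(V, A, s, t)` of dimension vector `d`. -/
abbrev QRep (s t : A → V) (d : V → ℕ) : Type :=
  ∀ a : A, Matrix (Fin (d (t a))) (Fin (d (s a))) ℂ

/-- The quiver Grassmannian `Gr_e(M)`: families of subspaces `N i ⊆ ℂ^{d i}` of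
dimension `e i` with `M_a (N (s a)) ⊆ N (t a)` for every arrow. -/
def SubRep (s t : A → V) {d : V → ℕ} (M : QRep s t d) (e : V → ℕ) : Type :=
  {N : ∀ i : V, Submodule ℂ (Fin (d i) → ℂ) //
    (∀ i, Module.finrank ℂ (N i) = e i) ∧
    ∀ a : A, (N (s a)).map (M a).mulVecLin ≤ N (t a)}

/-- The Zariski topology on the affine space `σ → ℂ`, induced from the Zariski
topology on the prime spectrum of the polynomial ring via `x ↦ ker (eval x)`. -/
def zariski (σ : Type) : TopologicalSpace (σ → ℂ) :=
  TopologicalSpace.induced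
    (fun x => (⟨RingHom.ker (MvPolynomial.eval x), RingHom.ker_isPrime _⟩ :
      PrimeSpectrum (MvPolynomial σ ℂ)))
    inferInstance

/-- Coordinates for a tuple of `(d i) × (e i)` matrices. -/
abbrev Coord (d e : V → ℕ) : Type := (Σ i : V, Fin (d i) × Fin (e i)) → ℂ

/-- The `i`-th matrix encoded by a coordinate vector. -/
def matOf {d e : V → ℕ} (F : Coord (V := V) d e) (i : V) :
    Matrix (Fin (d i)) (Fin (e i)) ℂ :=
  fun p q => F ⟨i, (p, q)⟩

/-- The affine "Stiefel-type" variety of tuples of injective linear maps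
`ℂ^{e i} → ℂ^{d i}` whose images form a subrepresentation of `M`. -/
def StQ (s t : A → V) {d : V → ℕ} (M : QRep s t d) (e : V → ℕ) : Type :=
  {F : Coord (V := V) d e //
    (∀ i, Function.Injective (matOf F i).mulVecLin) ∧
    ∀ a : A, (LinearMap.range (matOf F (s a)).mulVecLin).map (M a).mulVecLin ≤
      LinearMap.range (matOf F (t a)).mulVecLin}

/-- The canonical surjection from the Stiefel-type variety onto the quiver
Grassmannian, sending a tuple of injective maps to the tuple of their images. -/
def toSub (s t : A → V) {d : V → ℕ} (M : QRep s t d) (e : V → ℕ) :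
    StQ s t M e → SubRep s t M e := fun F =>
  ⟨fun i => LinearMap.range (matOf F.1 i).mulVecLin,
   fun i => by
     rw [LinearMap.finrank_range_of_inj (F.2.1 i)]
     exact Module.finrank_fin_fun ℂ,
   F.2.2⟩

/-- The Zariski topology on the quiver Grassmannian: the quotient (geometric
quotient) topology from the locally closed subset `StQ` of affine space. -/
instance (s t : A → V) {d : V → ℕ} (M : QRep s t d) (e : V → ℕ) :
    TopologicalSpace (SubRep s t M e) :=
  TopologicalSpace.coinduced (toSub s t M e)
    (TopologicalSpace.induced Subtype.val (zariski _))

/-- The map `Φ^M_N`, whose cokernel is `Ext¹_Q(N,M)`. -/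
def PhiFun (s t : A → V) {e d : V → ℕ} (N : QRep s t e) (M : QRep s t d) :
    (∀ i : V, Matrix (Fin (d i)) (Fin (e i)) ℂ) →
      (∀ a : A, Matrix (Fin (d (t a))) (Fin (e (s a))) ℂ) :=
  fun f a => M a * f (s a) - f (t a) * N a

/-- `Ext¹_Q(N, M) = 0`, expressed as surjectivity of `Φ^M_N` (whose cokernel
computes `Ext¹` via the standard resolution over the path algebra). -/
def ExtVanish (s t : A → V) {e d : V → ℕ} (N : QRep s t e) (M : QRep s t d) : Prop :=
  Function.Surjective (PhiFun s t N M)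

/-- A representation is rigid if `Ext¹_Q(M, M) = 0`. -/
def Rigid (s t : A → V) {d : V → ℕ} (M : QRep s t d) : Prop :=
  ExtVanish s t M M

/-- The Euler form `⟨x,y⟩ = Σ_i x i * y i − Σ_a x (s a) * y (t a)` of the quiver. -/
def eulerForm [Fintype V] [Fintype A] (s t : A → V) (x y : V → ℤ) : ℤ :=
  (∑ i : V, x i * y i) - ∑ a : A, x (s a) * y (t a)

/-- The quiver is Dynkin (disjoint union of simply-laced Dynkin diagrams), i.e. its
Tits form is positive definite. -/
def IsDynkin [Fintype V] [Fintype A] (s t : A → V) : Prop :=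
  ∀ x : V → ℤ, x ≠ 0 → 0 < eulerForm s t x x

/-- Morphisms of representations `X → Y`, given by matrices `φ i` with
`Y_a φ_{s a} = φ_{t a} X_a`. -/
def RHom (s t : A → V) {dX dY : V → ℕ} (X : QRep s t dX) (Y : QRep s t dY) : Type :=
  {φ : ∀ i : V, Matrix (Fin (dY i)) (Fin (dX i)) ℂ //
    ∀ a : A, Y a * φ (s a) = φ (t a) * X a}

/-- The space of morphisms of representations `Hom_Q(N, M)`. -/
def homRepC (s t : A → V) {e d : V → ℕ} (N : QRep s t e) (M : QRep s t d) :
    Submodule ℂ (∀ i : V, Matrix (Fin (d i)) (Fin (e i)) ℂ) where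
  carrier := {f | ∀ a : A, M a * f (s a) = f (t a) * N a}
  add_mem' := by
    intro f g hf hg a
    simp only [Pi.add_apply, Matrix.mul_add, Matrix.add_mul, hf a, hg a]
  zero_mem' := by intro a; simp
  smul_mem' := by
    intro c f hf a
    simp only [Pi.smul_apply, Matrix.mul_smul, Matrix.smul_mul, hf a]

/-- The stratum `S_{[N]}` of `Gr_e(M)`: points whose corresponding
subrepresentation is isomorphic to `N`. -/
def strat (s t : A → V) {d : V → ℕ} (M : QRep s t d) {e : V → ℕ}
    (N : QRep s t e) : Set (SubRep s t M e) :=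
  {x | ∃ φ : ∀ i : V, ((Fin (e i) → ℂ) ≃ₗ[ℂ] x.1 i),
    ∀ (a : A) (v : Fin (e (s a)) → ℂ),
      ((φ (t a)) ((N a).mulVecLin v) : Fin (d (t a)) → ℂ) =
        (M a).mulVecLin ((φ (s a)) v : Fin (d (s a)) → ℂ)}

open Topology TopologicalSpace

/-! ### Krull dimension and open covers -/

theorem topologicalKrullDim_le_of_open_nhds {X : Type*} [TopologicalSpace X] (n : WithBot ℕ∞)
    (h : ∀ x : X, ∃ U : Set X, IsOpen U ∧ x ∈ U ∧ topologicalKrullDim U ≤ n) :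
    topologicalKrullDim X ≤ n := by
  rw [topologicalKrullDim, Order.krullDim_eq_iSup_coheight]
  refine iSup_le fun Z => ?_
  obtain ⟨x, hx⟩ := Z.isIrreducible.nonempty
  obtain ⟨U, hU, hxU, hdim⟩ := h x
  have hf : IsOpenEmbedding (Subtype.val : U → X) := hU.isOpenEmbedding_subtypeVal
  let W := (IrreducibleCloseds.orderIsoOfIsOpenEmbedding _ hf).symm ⟨Z, ⟨⟨x, hxU⟩, hx⟩⟩
  have hW : IrreducibleCloseds.map _ hf.continuous W = Z :=
    congrArg Subtype.val
      ((IrreducibleCloseds.orderIsoOfIsOpenEmbedding _ hf).apply_symm_apply ⟨Z, ⟨⟨x, hxU⟩, hx⟩⟩)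
  rw [← hW, hf.coheight_map]
  exact (Order.coheight_le_krullDim W).trans hdim

/-! ### The Zariski topology on affine space -/

/-- The affine space `σ → ℂ`, endowed with its Zariski topology. -/
@[ext]
structure ZariskiSpace (σ : Type) : Type where
  /-- the coordinates of a point -/
  coords : σ → ℂ

instance (σ : Type) : TopologicalSpace (ZariskiSpace σ) := (zariski σ).induced ZariskiSpace.coords

namespace ZariskiSpace

variable {σ : Type}

theorem isInducing_toPrimeSpectrum : IsInducing (fun x : ZariskiSpace σ =>
    (⟨RingHom.ker (MvPolynomial.eval x.coords), RingHom.ker_isPrime _⟩ :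
      PrimeSpectrum (MvPolynomial σ ℂ))) :=
  ⟨induced_compose⟩

theorem isTopologicalBasis_nonvanishing :
    IsTopologicalBasis (Set.range fun f : MvPolynomial σ ℂ =>
      {x : ZariskiSpace σ | MvPolynomial.eval x.coords f ≠ 0}) := by
  have h := (PrimeSpectrum.isTopologicalBasis_basic_opens (R := MvPolynomial σ ℂ)).isInducing
    isInducing_toPrimeSpectrum
  convert! h using 1
  rw [← Set.range_comp]
  rfl

theorem isOpen_nonvanishing (f : MvPolynomial σ ℂ) :
    IsOpen {x : ZariskiSpace σ | MvPolynomial.eval x.coords f ≠ 0} :=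
  isTopologicalBasis_nonvanishing.isOpen ⟨f, rfl⟩

theorem topologicalKrullDim_le [Finite σ] :
    topologicalKrullDim (ZariskiSpace σ) ≤ (Nat.card σ : ℕ∞) := by
  refine isInducing_toPrimeSpectrum.topologicalKrullDim_le.trans ?_
  rw [PrimeSpectrum.topologicalKrullDim_eq_ringKrullDim,
    MvPolynomial.ringKrullDim_of_isNoetherianRing, ringKrullDim_eq_zero_of_field, zero_add]
  rfl

/-- An open set containing a point of a line contains all but finitely many points of it. -/
theorem finite_line_compl {U : Set (ZariskiSpace σ)} (hU : IsOpen U) (a v : σ → ℂ) (c₀ : ℂ)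
    {x : ZariskiSpace σ} (hx : x ∈ U) (h : x.coords = fun i => a i + c₀ * v i) :
    {c : ℂ | ZariskiSpace.mk (fun i => a i + c * v i) ∉ U}.Finite := by
  obtain ⟨_, ⟨f, rfl⟩, hf, hfU⟩ := isTopologicalBasis_nonvanishing.exists_subset_of_mem_open hx hU
  let p : Polynomial ℂ :=
    MvPolynomial.aeval (fun i => Polynomial.C (a i) + Polynomial.X * Polynomial.C (v i)) f
  have hp : ∀ c, p.eval c = MvPolynomial.eval (fun i => a i + c * v i) f := by
    intro c
    rw [← Polynomial.coe_evalRingHom]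
    simp only [p, MvPolynomial.aeval_def, MvPolynomial.eval, MvPolynomial.eval₂Hom]
    change Polynomial.evalRingHom c (MvPolynomial.eval₂ _ _ f) = MvPolynomial.eval₂ _ _ f
    rw [MvPolynomial.eval₂_comp_left]
    congr 1
    · ext; simp
    · funext i; simp; ring
  have hp0 : p ≠ 0 := by
    intro h0
    apply hf
    rw [h, ← hp, h0, Polynomial.eval_zero]
  refine (Polynomial.finite_setOfPred_isRoot hp0).subset fun c hc => ?_
  by_contra hne
  refine hc (hfU ?_)
  change MvPolynomial.eval _ f ≠ 0
  rwa [← hp]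

theorem isPreirreducible_of_lines {S O : Set (ZariskiSpace σ)} (hO : IsOpen O)
    (hS : ∀ x ∈ S, ∀ y ∈ S, ∀ c : ℂ, 
      (⟨fun i => x.coords i + c * (y.coords i - x.coords i)⟩ : ZariskiSpace σ) ∈ S) :
    IsPreirreducible (S ∩ O) := by
  rintro U W hU hW ⟨x, ⟨hxS, hxO⟩, hxU⟩ ⟨y, ⟨hyS, hyO⟩, hyW⟩
  have h1 := finite_line_compl (hO.inter hU) x.coords (fun i => y.coords i - x.coords i) 0 ⟨hxO, hxU⟩
    (by funext i; simp)
  have h2 := finite_line_compl hW x.coords (fun i => y.coords i - x.coords i) 1 hyW (by funext i; simp)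
  obtain ⟨c, hc⟩ := (h1.union h2).infinite_compl.nonempty
  simp only [Set.mem_compl_iff, Set.mem_union, Set.mem_ofPred_eq, not_or, not_not] at hc
  exact ⟨_, ⟨hS x hxS y hyS c, hc.1.1⟩, hc.1.2, hc.2⟩

theorem le_topologicalKrullDim_of_isOpen {r : ℕ} {O : Set (ZariskiSpace (Fin r))} (hO : IsOpen O)
    (hne : O.Nonempty) : ((r : ℕ∞) : WithBot ℕ∞) ≤ topologicalKrullDim O := by
  obtain ⟨x₀, hx₀⟩ := hne
  let S : ℕ → Set (ZariskiSpace (Fin r)) := fun k => {x | ∀ i : Fin r, k ≤ i → x.coords i = x₀.coords i}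
  have hSc : ∀ k, IsClosed (S k) := by
    intro k
    have : S k = ⋂ (i : Fin r) (_ : k ≤ i), {x : ZariskiSpace (Fin r) |
        MvPolynomial.eval x.coords (MvPolynomial.X i - MvPolynomial.C (x₀.coords i)) ≠ 0}ᶜ := by
      ext x
      simp [S, sub_eq_zero]
    rw [this]
    exact isClosed_iInter fun i => isClosed_iInter fun _ => (isOpen_nonvanishing _).isClosed_compl
  let Z : ℕ → IrreducibleCloseds O := fun k =>
    { carrier := Subtype.val ⁻¹' S k
      isIrreducible' := by
        refine ⟨⟨⟨x₀, hx₀⟩, fun _ _ => rfl⟩, ?_⟩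
        have h : IsPreirreducible (S k ∩ O) := isPreirreducible_of_lines hO fun x hx y hy c i hi => by
          change x.coords i + c * (y.coords i - x.coords i) = _
          rw [hx i hi, hy i hi, sub_self, mul_zero, add_zero]
        have := h.preimage hO.isOpenEmbedding_subtypeVal
        rwa [Set.preimage_inter, Subtype.coe_preimage_self, Set.inter_univ] at this
      isClosed' := (hSc k).preimage continuous_subtype_val }
  let p : LTSeries (IrreducibleCloseds O) :=
    { length := r
      toFun := fun k => Z k
      step := by
        intro k
        refine lt_of_le_of_ne (show (Z k.castSucc : Set O) ⊆ Z k.succ from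
          fun x hx i hi => hx i ?_) fun h => ?_
        · simp at hi ⊢; lia
        · have hfin := finite_line_compl hO x₀.coords (Pi.single k 1) 0 hx₀ (by funext i; simp)
          obtain ⟨c, hc⟩ := (hfin.union (Set.finite_singleton 0)).infinite_compl.nonempty
          simp only [Set.mem_compl_iff, Set.mem_union, Set.mem_ofPred_eq, not_or, not_not,
            Set.mem_singleton_iff] at hc
          let y : O := ⟨_, hc.1⟩
          have hy : y ∈ Z (k.succ : Fin (r + 1)) := by
            intro i hi
            have : i ≠ k := by rintro rfl; simp at hi
            simp [y, this]
          replace hy : y ∈ (Z k.castSucc : Set O) := h.symm ▸ hy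
          have := hy k (by simp)
          simp [y, hc.2] at this }
  exact Order.LTSeries.length_le_krullDim p

theorem topologicalKrullDim_of_isOpen {r : ℕ} {O : Set (ZariskiSpace (Fin r))} (hO : IsOpen O)
    (hne : O.Nonempty) : topologicalKrullDim O = ((r : ℕ∞) : WithBot ℕ∞) :=
  le_antisymm
    ((topologicalKrullDim_subspace_le _ O).trans (topologicalKrullDim_le.trans_eq (by simp)))
    (le_topologicalKrullDim_of_isOpen hO hne)

end ZariskiSpace

/-- If every point of a nonempty space has an open neighborhood homeomorphic to an open subset of
affine `r`-space, then the space has Krull dimension `r`. -/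
theorem topologicalKrullDim_of_locally_affine {X : Type*} [TopologicalSpace X] [Nonempty X] (r : ℕ)
    (h : ∀ x : X, ∃ U : Set X, IsOpen U ∧ x ∈ U ∧
      ∃ O : Set (ZariskiSpace (Fin r)), IsOpen O ∧ Nonempty (U ≃ₜ O)) :
    topologicalKrullDim X = ((r : ℕ∞) : WithBot ℕ∞) := by
  have key : ∀ x : X, ∃ U : Set X, IsOpen U ∧ x ∈ U ∧ topologicalKrullDim U = (r : ℕ∞) := by
    intro x
    obtain ⟨U, hU, hx, O, hO, ⟨φ⟩⟩ := h x
    refine ⟨U, hU, hx, ?_⟩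
    rw [IsHomeomorph.topologicalKrullDim_eq _ φ.isHomeomorph]
    exact ZariskiSpace.topologicalKrullDim_of_isOpen hO ⟨_, (φ ⟨x, hx⟩).2⟩
  apply le_antisymm
  · exact topologicalKrullDim_le_of_open_nhds _ fun x =>
      (key x).imp fun U hU => ⟨hU.1, hU.2.1, hU.2.2.le⟩
  · obtain ⟨U, -, -, hU⟩ := key (Classical.arbitrary X)
    exact hU.symm.le.trans (topologicalKrullDim_subspace_le X U)

/-! ### Regular functions -/

/-- The algebra of functions on `Y` which are quotients of polynomials in the coordinates
provided by `ι`, with nowhere vanishing denominator. -/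
def regularFunctions {Y σ : Type} (ι : Y → σ → ℂ) : Subalgebra ℂ (Y → ℂ) where
  carrier := {u | ∃ P Q : MvPolynomial σ ℂ, ∀ y, MvPolynomial.eval (ι y) Q ≠ 0 ∧
    MvPolynomial.eval (ι y) Q * u y = MvPolynomial.eval (ι y) P}
  mul_mem' := by
    rintro u v ⟨P, Q, h⟩ ⟨P', Q', h'⟩
    refine ⟨P * P', Q * Q', fun y => ⟨?_, ?_⟩⟩
    · simpa using ⟨(h y).1, (h' y).1⟩
    · rw [map_mul, map_mul, ← (h y).2, ← (h' y).2, Pi.mul_apply]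
      ring
  add_mem' := by
    rintro u v ⟨P, Q, h⟩ ⟨P', Q', h'⟩
    refine ⟨P * Q' + P' * Q, Q * Q', fun y => ⟨?_, ?_⟩⟩
    · simpa using ⟨(h y).1, (h' y).1⟩
    · rw [map_mul, map_add, map_mul, map_mul, ← (h y).2, ← (h' y).2, Pi.add_apply]
      ring
  algebraMap_mem' := fun c => ⟨MvPolynomial.C c, 1, fun y => by simp⟩

namespace regularFunctions

variable {Y σ : Type} {ι : Y → σ → ℂ}

theorem coord_mem (j : σ) : (fun y => ι y j) ∈ regularFunctions ι :=
  ⟨MvPolynomial.X j, 1, fun y => by simp⟩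

theorem const_mem (c : ℂ) : (fun _ => c) ∈ regularFunctions ι :=
  (regularFunctions ι).algebraMap_mem c

theorem fun_sum_mem {κ : Type*} (S : Finset κ) {u : κ → Y → ℂ}
    (h : ∀ k ∈ S, u k ∈ regularFunctions ι) :
    (fun y => ∑ k ∈ S, u k y) ∈ regularFunctions ι := by
  have := (regularFunctions ι).sum_mem h
  rwa [Finset.sum_fn] at this

theorem fun_mul_mem {u v : Y → ℂ} (hu : u ∈ regularFunctions ι) (hv : v ∈ regularFunctions ι) :
    (fun y => u y * v y) ∈ regularFunctions ι :=
  (regularFunctions ι).mul_mem hu hv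

theorem linear_mem [Finite σ] (l : (σ → ℂ) →ₗ[ℂ] ℂ) :
    (fun y => l (ι y)) ∈ regularFunctions ι := by
  classical
  have := Fintype.ofFinite σ
  have h : (fun y => l (ι y)) = fun y => ∑ j, ι y j * l (fun k => if j = k then 1 else 0) := by
    funext y
    simpa using l.pi_apply_eq_sum_univ (ι y)
  rw [h]
  exact fun_sum_mem _ fun j _ => fun_mul_mem (coord_mem j) (const_mem _)

theorem inv_mem {u : Y → ℂ} (hu : u ∈ regularFunctions ι) (h0 : ∀ y, u y ≠ 0) :
    (fun y => (u y)⁻¹) ∈ regularFunctions ι := by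
  obtain ⟨P, Q, h⟩ := hu
  refine ⟨Q, P, fun y => ⟨?_, ?_⟩⟩
  · rw [← (h y).2]
    exact mul_ne_zero (h y).1 (h0 y)
  · rw [← (h y).2, mul_assoc, mul_inv_cancel₀ (h0 y), mul_one]

variable {n : Type} [Fintype n] [DecidableEq n]

theorem det_mem {m : Y → Matrix n n ℂ} (hm : ∀ i j, (fun y => m y i j) ∈ regularFunctions ι) :
    (fun y => (m y).det) ∈ regularFunctions ι := by
  simp only [Matrix.det_apply']
  refine fun_sum_mem _ fun τ _ => fun_mul_mem (const_mem _) ?_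
  have := (regularFunctions ι).prod_mem (t := Finset.univ) fun i _ => hm (τ i) i
  rwa [Finset.prod_fn] at this

theorem inv_apply_mem {m : Y → Matrix n n ℂ}
    (hm : ∀ i j, (fun y => m y i j) ∈ regularFunctions ι) (h0 : ∀ y, (m y).det ≠ 0) (i j : n) :
    (fun y => (m y)⁻¹ i j) ∈ regularFunctions ι := by
  simp only [Matrix.inv_def, Matrix.smul_apply, Ring.inverse_eq_inv, smul_eq_mul,
    Matrix.adjugate_apply]
  refine fun_mul_mem (inv_mem (det_mem hm) h0) (det_mem fun k l => ?_)
  by_cases hk : k = j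
  · subst hk
    simpa using const_mem _
  · simpa [Matrix.updateRow_ne hk] using hm k l

theorem isOpen_ne_zero [TopologicalSpace Y]
    (hι : Continuous (fun y => ZariskiSpace.mk (ι y))) {u : Y → ℂ}
    (hu : u ∈ regularFunctions ι) : IsOpen {y | u y ≠ 0} := by
  obtain ⟨P, Q, h⟩ := hu
  convert (ZariskiSpace.isOpen_nonvanishing P).preimage hι using 1
  ext y
  change u y ≠ 0 ↔ MvPolynomial.eval (ι y) P ≠ 0
  rw [← (h y).2, mul_ne_zero_iff]
  exact (and_iff_right (h y).1).symm

theorem continuous_of_coord_mem {τ : Type} [TopologicalSpace Y]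
    (hι : Continuous (fun y => ZariskiSpace.mk (ι y))) {ψ : Y → ZariskiSpace τ}
    (h : ∀ j, (fun y => (ψ y).coords j) ∈ regularFunctions ι) : Continuous ψ := by
  rw [ZariskiSpace.isTopologicalBasis_nonvanishing.continuous_iff]
  rintro _ ⟨f, rfl⟩
  refine isOpen_ne_zero (u := fun y => MvPolynomial.eval ((ψ y).coords) f) hι ?_
  have h2 : (fun y => MvPolynomial.eval ((ψ y).coords) f) =
      MvPolynomial.aeval (fun j y => (ψ y).coords j) f := by
    funext y
    change MvPolynomial.eval ((ψ y).coords) f =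
      Pi.evalAlgHom ℂ (fun _ : Y => ℂ) y (MvPolynomial.aeval (fun j y => (ψ y).coords j) f)
    rw [← AlgHom.comp_apply, MvPolynomial.comp_aeval]
    rfl
  rw [h2]
  have h3 := (MvPolynomial.aeval (R := ℂ)
    (fun j => (⟨fun y => (ψ y).coords j, h j⟩ : regularFunctions ι)) f).2
  rw [← Subalgebra.coe_val, ← AlgHom.comp_apply, MvPolynomial.comp_aeval] at h3
  exact h3

end regularFunctions

/-! ### Slices for the action of the units of an algebra -/

/-- A right action of a complex algebra `E` on affine space `σ → ℂ`, together with a linear map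
`β`, a linear map `R` back to the algebra, and a value `b` of `β` normalizing the points
of an orbit. -/
structure SliceDatum (σ E B : Type) [Ring E] [Algebra ℂ E] [AddCommGroup B] [Module ℂ B] where
  /-- the right action of `E` -/
  act : (σ → ℂ) →ₗ[ℂ] E →ₗ[ℂ] (σ → ℂ)
  act_one : ∀ F, act F 1 = F
  act_act : ∀ F g h, act (act F g) h = act F (g * h)
  /-- the linear map defining the slice -/
  β : (σ → ℂ) →ₗ[ℂ] B
  /-- the linear map turning the normalization equation into a square system -/
  R : B →ₗ[ℂ] E
  /-- the value of `β` defining the slice -/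
  b : B

namespace SliceDatum

variable {σ E B : Type} [Ring E] [Algebra ℂ E] [AddCommGroup B] [Module ℂ B]
  (S : SliceDatum σ E B)

/-- The endomorphism of `E` whose invertibility makes the normalization problem uniquely
solvable. -/
def system (F : σ → ℂ) : Module.End ℂ E := S.R ∘ₗ S.β ∘ₗ S.act F

/-- The normalizing element of `E`. -/
def sol (F : σ → ℂ) : E := Ring.inverse (S.system F) (S.R S.b)

/-- The normalization of a point. -/
def normalize (F : σ → ℂ) : σ → ℂ := S.act F (S.sol F)

/-- The locus of points which can be normalized by a unit. -/
def domain : Set (σ → ℂ) := {F | IsUnit (S.system F) ∧ IsUnit (S.sol F)}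

theorem system_apply (F : σ → ℂ) (g : E) : S.system F g = S.R (S.β (S.act F g)) := rfl

variable {S}

theorem system_sol {F : σ → ℂ} (h : IsUnit (S.system F)) : S.system F (S.sol F) = S.R S.b := by
  rw [sol, ← Module.End.mul_apply, Ring.mul_inverse_cancel _ h, Module.End.one_apply]

theorem system_injective {F : σ → ℂ} (h : IsUnit (S.system F)) :
    Function.Injective (S.system F) :=
  ((Module.End.isUnit_iff _).1 h).1

theorem sol_eq {F : σ → ℂ} (h : IsUnit (S.system F)) {g : E} (hg : S.β (S.act F g) = S.b) :
    S.sol F = g :=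
  system_injective h (by rw [system_sol h, system_apply, hg])

theorem act_injective {F : σ → ℂ} (h : IsUnit (S.system F)) : Function.Injective (S.act F) :=
  fun g g' hg => system_injective h (by rw [system_apply, system_apply, hg])

theorem sol_eq_one {F : σ → ℂ} (h : IsUnit (S.system F)) (hF : S.β F = S.b) : S.sol F = 1 :=
  sol_eq h (by rw [S.act_one, hF])

theorem mem_domain_of_slice {F : σ → ℂ} (h : IsUnit (S.system F)) (hF : S.β F = S.b) :
    F ∈ S.domain :=
  ⟨h, by rw [sol_eq_one h hF]; exact isUnit_one⟩

theorem normalize_of_slice {F : σ → ℂ} (h : IsUnit (S.system F)) (hF : S.β F = S.b) :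
    S.normalize F = F := by
  rw [normalize, sol_eq_one h hF, S.act_one]

theorem isUnit_mulLeft (u : Eˣ) : IsUnit (LinearMap.mulLeft ℂ (u : E)) :=
  (u.isUnit.map (Algebra.lmul ℂ E))

theorem system_act (F : σ → ℂ) (g : E) :
    S.system (S.act F g) = S.system F * LinearMap.mulLeft ℂ g := by
  ext h
  simp [system_apply, S.act_act]

theorem isUnit_system_act {F : σ → ℂ} (h : IsUnit (S.system F)) (u : Eˣ) :
    IsUnit (S.system (S.act F u)) := by
  rw [system_act]
  exact h.mul (isUnit_mulLeft u)

theorem sol_act {F : σ → ℂ} (h : IsUnit (S.system F)) (u : Eˣ) :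
    S.sol (S.act F u) = ↑u⁻¹ * S.sol F := by
  apply system_injective (isUnit_system_act h u)
  rw [system_sol (isUnit_system_act h u), system_act, Module.End.mul_apply,
    LinearMap.mulLeft_apply, Units.mul_inv_cancel_left, system_sol h]

theorem act_mem_domain {F : σ → ℂ} (h : F ∈ S.domain) (u : Eˣ) : S.act F u ∈ S.domain :=
  ⟨isUnit_system_act h.1 u, by rw [sol_act h.1]; exact u⁻¹.isUnit.mul h.2⟩

theorem normalize_act {F : σ → ℂ} (h : F ∈ S.domain) (u : Eˣ) :
    S.normalize (S.act F u) = S.normalize F := by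
  rw [normalize, sol_act h.1, S.act_act, Units.mul_inv_cancel_left, normalize]

theorem exists_unit_act_eq_normalize {F : σ → ℂ} (h : F ∈ S.domain) :
    ∃ u : Eˣ, S.act F u = S.normalize F :=
  ⟨h.2.unit, rfl⟩

section Regularity

variable [FiniteDimensional ℂ E]

theorem isUnit_iff_norm_ne_zero (g : E) : IsUnit g ↔ Algebra.norm ℂ g ≠ 0 := by
  refine ⟨fun h => (h.map (Algebra.norm ℂ)).ne_zero, fun h => ?_⟩
  rw [Algebra.norm_apply] at h
  have hu : IsUnit (Algebra.lmul ℂ E g) :=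
    (LinearMap.isUnit_iff_isUnit_det _).2 (isUnit_iff_ne_zero.2 h)
  have hb := (Module.End.isUnit_iff _).1 hu
  obtain ⟨k, hk⟩ := hb.2 1
  have hk : g * k = 1 := hk
  refine ⟨⟨g, k, hk, hb.1 ?_⟩, rfl⟩
  change g * (k * g) = g * 1
  rw [← mul_assoc, hk, one_mul, mul_one]

variable (S)

/-- The matrix of `system`. -/
def systemMatrix (F : σ → ℂ) : Matrix (Fin (Module.finrank ℂ E)) (Fin (Module.finrank ℂ E)) ℂ :=
  LinearMap.toMatrix (Module.finBasis ℂ E) (Module.finBasis ℂ E) (S.system F)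

theorem isUnit_system_iff (F : σ → ℂ) : IsUnit (S.system F) ↔ (S.systemMatrix F).det ≠ 0 := by
  rw [LinearMap.isUnit_iff_isUnit_det, isUnit_iff_ne_zero, systemMatrix, LinearMap.det_toMatrix]

theorem repr_sol {F : σ → ℂ} (h : IsUnit (S.system F)) :
    (Module.finBasis ℂ E).repr (S.sol F) =
      (S.systemMatrix F)⁻¹ *ᵥ (Module.finBasis ℂ E).repr (S.R S.b) := by
  have hdet : IsUnit (S.systemMatrix F).det := isUnit_iff_ne_zero.2 ((S.isUnit_system_iff F).1 h)
  rw [← system_sol h, ← LinearMap.toMatrix_mulVec_repr (Module.finBasis ℂ E) (Module.finBasis ℂ E)]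
  change _ = (S.systemMatrix F)⁻¹ *ᵥ (S.systemMatrix F *ᵥ _)
  rw [Matrix.mulVec_mulVec, Matrix.nonsing_inv_mul _ hdet, Matrix.one_mulVec]

theorem sol_eq_sum (F : σ → ℂ) : S.sol F =
    ∑ i, (Module.finBasis ℂ E).repr (S.sol F) i • Module.finBasis ℂ E i :=
  ((Module.finBasis ℂ E).sum_repr _).symm

variable [Finite σ]

theorem systemMatrix_mem {Y : Type} (ι : Y → σ → ℂ) (i j : Fin (Module.finrank ℂ E)) :
    (fun y => S.systemMatrix (ι y) i j) ∈ regularFunctions ι := by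
  convert regularFunctions.linear_mem (ι := ι)
    ((Module.finBasis ℂ E).coord i ∘ₗ S.R ∘ₗ S.β ∘ₗ S.act.flip (Module.finBasis ℂ E j)) using 2
  simp [systemMatrix, LinearMap.toMatrix_apply, system_apply]

/-- The locus where the normalization problem is uniquely solvable. -/
abbrev Solvable : Type := {F : ZariskiSpace σ // IsUnit (S.system F.coords)}

theorem isOpen_solvable : IsOpen {F : ZariskiSpace σ | IsUnit (S.system F.coords)} := by
  simp only [isUnit_system_iff]
  exact regularFunctions.isOpen_ne_zero (ι := ZariskiSpace.coords) continuous_id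
    (regularFunctions.det_mem (S.systemMatrix_mem _))

/-- The coordinates on the solvable locus. -/
abbrev Solvable.coords (F : S.Solvable) : σ → ℂ := F.1.coords

theorem repr_sol_mem (i : Fin (Module.finrank ℂ E)) :
    (fun F : S.Solvable => (Module.finBasis ℂ E).repr (S.sol F.1.coords) i) ∈
      regularFunctions (Solvable.coords S) := by
  have h : (fun F : S.Solvable => (Module.finBasis ℂ E).repr (S.sol F.1.coords) i) =
      fun F : S.Solvable => ∑ j, (S.systemMatrix F.1.coords)⁻¹ i j *
        (Module.finBasis ℂ E).repr (S.R S.b) j := by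
    funext F
    rw [S.repr_sol F.2]
    rfl
  rw [h]
  exact regularFunctions.fun_sum_mem _ fun j _ => regularFunctions.fun_mul_mem
    (regularFunctions.inv_apply_mem (S.systemMatrix_mem _)
      (fun F => (S.isUnit_system_iff _).1 F.2) i j) (regularFunctions.const_mem _)

theorem linear_sol_mem (l : E →ₗ[ℂ] ℂ) :
    (fun F : S.Solvable => l (S.sol F.1.coords)) ∈ regularFunctions (Solvable.coords S) := by
  have h : (fun F : S.Solvable => l (S.sol F.1.coords)) = fun F : S.Solvable =>
      ∑ i, (Module.finBasis ℂ E).repr (S.sol F.1.coords) i * l (Module.finBasis ℂ E i) := by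
    funext F
    refine (congrArg l (S.sol_eq_sum F.1.coords)).trans ?_
    simp only [map_sum, map_smul, smul_eq_mul]
  rw [h]
  exact regularFunctions.fun_sum_mem _ fun i _ => regularFunctions.fun_mul_mem
    (S.repr_sol_mem i) (regularFunctions.const_mem _)

theorem linear_normalize_mem (l : (σ → ℂ) →ₗ[ℂ] ℂ) :
    (fun F : S.Solvable => l (S.normalize F.1.coords)) ∈ regularFunctions (Solvable.coords S) := by
  have h : (fun F : S.Solvable => l (S.normalize F.1.coords)) = fun F : S.Solvable =>
      ∑ i, (Module.finBasis ℂ E).repr (S.sol F.1.coords) i *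
        (l ∘ₗ S.act.flip (Module.finBasis ℂ E i)) (Solvable.coords S F) := by
    funext F
    refine (congrArg (fun g => l (S.act F.1.coords g)) (S.sol_eq_sum F.1.coords)).trans ?_
    simp only [map_sum, map_smul, smul_eq_mul]
    rfl
  rw [h]
  exact regularFunctions.fun_sum_mem _ fun i _ => regularFunctions.fun_mul_mem
    (S.repr_sol_mem i) (regularFunctions.linear_mem _)

theorem isOpen_domain : IsOpen (ZariskiSpace.coords ⁻¹' S.domain) := by
  have h : IsOpen {F : S.Solvable | Algebra.norm ℂ (S.sol F.1.coords) ≠ 0} := by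
    refine regularFunctions.isOpen_ne_zero (ι := Solvable.coords S) continuous_subtype_val ?_
    simp only [Algebra.norm_eq_matrix_det (Module.finBasis ℂ E)]
    refine regularFunctions.det_mem fun i j => ?_
    simp only [Algebra.leftMulMatrix_eq_repr_mul]
    exact S.linear_sol_mem ((Module.finBasis ℂ E).coord i ∘ₗ
      LinearMap.mulRight ℂ (Module.finBasis ℂ E j))
  convert S.isOpen_solvable.isOpenEmbedding_subtypeVal.isOpenMap _ h using 1
  ext F
  simp [domain, isUnit_iff_norm_ne_zero (E := E), and_comm]

theorem continuousOn_affine_normalize {τ : Type} (l : (σ → ℂ) →ₗ[ℂ] (τ → ℂ)) (c : σ → ℂ) :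
    ContinuousOn (fun F : ZariskiSpace σ => ZariskiSpace.mk (l (S.normalize F.coords - c)))
      (ZariskiSpace.coords ⁻¹' S.domain) := by
  have h : ContinuousOn (fun F : ZariskiSpace σ => ZariskiSpace.mk (l (S.normalize F.coords - c)))
      {F : ZariskiSpace σ | IsUnit (S.system F.coords)} := by
    rw [continuousOn_iff_continuous_domRestrict]
    refine regularFunctions.continuous_of_coord_mem (ι := Solvable.coords S)
      continuous_subtype_val fun j => ?_
    change (fun F : S.Solvable => l (S.normalize F.1.coords - c) j) ∈ _
    simp only [map_sub, Pi.sub_apply]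
    exact (regularFunctions _).sub_mem (S.linear_normalize_mem (LinearMap.proj j ∘ₗ l))
      (regularFunctions.const_mem (l c j))
  exact h.mono fun F hF => hF.1

theorem isOpen_normalize_ne :
    IsOpen {F : ZariskiSpace σ | F.coords ∈ S.domain ∧ S.β (S.normalize F.coords) ≠ S.b} := by
  have h : IsOpen (⋃ l : Module.Dual ℂ B,
      {F : S.Solvable | l (S.β (S.normalize F.1.coords)) - l S.b ≠ 0}) :=
    isOpen_iUnion fun l => regularFunctions.isOpen_ne_zero (ι := Solvable.coords S)
      continuous_subtype_val ((regularFunctions _).sub_mem (S.linear_normalize_mem (l ∘ₗ S.β))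
        (regularFunctions.const_mem (l S.b)))
  convert S.isOpen_domain.inter (S.isOpen_solvable.isOpenEmbedding_subtypeVal.isOpenMap _ h) using 1
  ext F
  have key : (∃ l : Module.Dual ℂ B, l (S.β (S.normalize F.coords)) - l S.b ≠ 0) ↔
      S.β (S.normalize F.coords) ≠ S.b := by
    rw [← not_iff_not]
    simp only [← map_sub]
    push Not
    rw [Module.forall_dual_apply_eq_zero_iff, sub_eq_zero]
  simp only [Set.mem_inter_iff, Set.mem_preimage, Set.mem_image, Set.mem_iUnion, Subtype.exists,
    exists_and_right, exists_eq_right, Set.mem_ofPred_eq, key]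
  exact ⟨fun h => ⟨h.1, h.1.1, h.2⟩, fun h => ⟨h.1, h.2.2⟩⟩

end Regularity

end SliceDatum

/-- Slices through a point `F₀` of `ker δ` whose stabilizing subspace is `D`. -/
theorem exists_sliceDatum {σ E B : Type} [Ring E] [Algebra ℂ E] [AddCommGroup B] [Module ℂ B]
    (act : (σ → ℂ) →ₗ[ℂ] E →ₗ[ℂ] (σ → ℂ)) (act_one : ∀ F, act F 1 = F)
    (act_act : ∀ F g h, act (act F g) h = act F (g * h)) (δ : (σ → ℂ) →ₗ[ℂ] B)
    (D : Submodule ℂ E) (hD : 1 ∈ D) (F₀ : σ → ℂ) (h₀ : δ F₀ = 0)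
    (hinj : Function.Injective (act F₀)) (hstab : ∀ g, δ (act F₀ g) = 0 → g ∈ D) :
    ∃ (S : SliceDatum σ E (B × D)) (q : (σ → ℂ) →ₗ[ℂ] D), S.act = act ∧ S.β = δ.prod q ∧
      S.b = (0, ⟨1, hD⟩) ∧ (∀ g : D, q (act F₀ g) = g) ∧ IsUnit (S.system F₀) ∧ S.β F₀ = S.b := by
  obtain ⟨q, hq⟩ := (act F₀ ∘ₗ D.subtype).exists_leftInverse_of_injective
    (LinearMap.ker_eq_bot.2 (hinj.comp D.injective_subtype))
  have hq' : ∀ g : D, q (act F₀ g) = g := fun g => LinearMap.congr_fun hq g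
  have hβ : Function.Injective ((δ.prod q) ∘ₗ act F₀) := by
    rw [← LinearMap.ker_eq_bot, LinearMap.ker_eq_bot']
    intro g hg
    obtain ⟨h1, h2⟩ := Prod.ext_iff.1 hg
    have := hq' ⟨g, hstab g h1⟩
    exact congrArg Subtype.val (this.symm.trans h2)
  obtain ⟨R, hR⟩ := ((δ.prod q) ∘ₗ act F₀).exists_leftInverse_of_injective
    (LinearMap.ker_eq_bot.2 hβ)
  refine ⟨⟨act, act_one, act_act, δ.prod q, R, (0, ⟨1, hD⟩)⟩, q, rfl, rfl, rfl, hq', ?_, ?_⟩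
  · convert (isUnit_one : IsUnit (1 : Module.End ℂ E))
    exact hR
  · refine Prod.ext h₀ ?_
    have := hq' ⟨1, hD⟩
    rwa [act_one] at this

theorem finrank_ker_prod_add {C B D : Type} [AddCommGroup C] [Module ℂ C] [FiniteDimensional ℂ C]
    [AddCommGroup B] [Module ℂ B] [AddCommGroup D] [Module ℂ D]
    (δ : C →ₗ[ℂ] B) (q : C →ₗ[ℂ] D) (hq : ∀ g, ∃ x, δ x = 0 ∧ q x = g) :
    Module.finrank ℂ (LinearMap.ker (δ.prod q)) + Module.finrank ℂ D =
      Module.finrank ℂ (LinearMap.ker δ) := by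
  have h := LinearMap.finrank_range_add_finrank_ker (q.domRestrict (LinearMap.ker δ))
  have h1 : LinearMap.range (q.domRestrict (LinearMap.ker δ)) = ⊤ := by
    rw [LinearMap.range_eq_top]
    intro g
    obtain ⟨x, hx, hxg⟩ := hq g
    exact ⟨⟨x, hx⟩, hxg⟩
  have h2 : (LinearMap.ker (q.domRestrict (LinearMap.ker δ))).map (LinearMap.ker δ).subtype =
      LinearMap.ker (δ.prod q) := by
    ext x
    simp [LinearMap.ker_prod, and_comm]
  rw [h1, finrank_top, ← Submodule.finrank_map_subtype_eq, h2] at h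
  rw [← h, add_comm]

/-- On the domain of a slice, the points which can be moved into `ker δ` are those whose
normalization lies in the slice. -/
theorem exists_unit_iff_normalize {σ E B : Type} [Ring E] [Algebra ℂ E] [FiniteDimensional ℂ E]
    [AddCommGroup B] [Module ℂ B] {D : Submodule ℂ E} (hD : 1 ∈ D) {δ : (σ → ℂ) →ₗ[ℂ] B}
    {q : (σ → ℂ) →ₗ[ℂ] D} {S : SliceDatum σ E (B × D)} (hβ : S.β = δ.prod q)
    (hb : S.b = (0, ⟨1, hD⟩)) (hδ : ∀ F, δ F = 0 → ∀ g ∈ D, δ (S.act F g) = 0) {F : σ → ℂ}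
    (hF : F ∈ S.domain) :
    (∃ u : Eˣ, δ (S.act F u) = 0) ↔ S.β (S.normalize F) = S.b := by
  constructor
  · rintro ⟨u, hu⟩
    let k : D →ₗ[ℂ] D := q ∘ₗ S.act (S.act F u) ∘ₗ D.subtype
    have hk : Function.Injective k := by
      rw [← LinearMap.ker_eq_bot, LinearMap.ker_eq_bot']
      intro g hg
      have h0 : S.system (S.act F u) g = 0 := by
        rw [SliceDatum.system_apply, hβ, LinearMap.prod_apply]
        change S.R (δ _, k g) = 0
        rw [hg, hδ _ hu _ g.2]
        exact map_zero _
      exact Subtype.ext (SliceDatum.system_injective (SliceDatum.isUnit_system_act hF.1 u)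
        (h0.trans (map_zero _).symm))
    obtain ⟨g, hg⟩ := LinearMap.surjective_of_injective hk ⟨1, hD⟩
    have hs : S.β (S.act F (u * g)) = S.b := by
      rw [hβ, hb, ← S.act_act, LinearMap.prod_apply]
      exact Prod.ext (hδ _ hu _ g.2) hg
    rw [SliceDatum.normalize, SliceDatum.sol_eq hF.1 hs, hs]
  · intro h
    obtain ⟨u, hu⟩ := SliceDatum.exists_unit_act_eq_normalize hF
    refine ⟨u, ?_⟩
    rw [hu]
    rw [hβ, hb] at h
    exact (Prod.ext_iff.1 h).1

/-! ### Tuples of matrices -/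

/-- The algebra of tuples of square matrices, whose units act by changes of basis. -/
abbrev BlockAlg (e : V → ℕ) : Type := ∀ i : V, Matrix (Fin (e i)) (Fin (e i)) ℂ

/-- The linear equivalence between coordinate vectors and tuples of matrices. -/
def matEquiv (d e : V → ℕ) : Coord d e ≃ₗ[ℂ] (∀ i : V, Matrix (Fin (d i)) (Fin (e i)) ℂ) where
  toFun F := matOf F
  invFun f x := f x.1 x.2.1 x.2.2
  map_add' _ _ := rfl
  map_smul' _ _ := rfl
  left_inv _ := rfl
  right_inv _ := rfl

/-- Composition of a tuple of matrices with a tuple of square matrices. -/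
def coordAct (d e : V → ℕ) : Coord d e →ₗ[ℂ] BlockAlg e →ₗ[ℂ] Coord d e :=
  LinearMap.mk₂ ℂ (fun F g => (matEquiv d e).symm fun i => matOf F i * g i)
    (fun F F' g => by
      rw [← map_add]
      exact congrArg _ (funext fun i => Matrix.add_mul (matOf F i) (matOf F' i) (g i)))
    (fun c F g => by
      rw [← map_smul]
      exact congrArg _ (funext fun i => Matrix.smul_mul c (matOf F i) (g i)))
    (fun F g g' => by
      rw [← map_add]
      exact congrArg _ (funext fun i => Matrix.mul_add (matOf F i) (g i) (g' i)))
    (fun c F g => by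
      rw [← map_smul]
      exact congrArg _ (funext fun i => Matrix.mul_smul (matOf F i) c (g i)))

@[simp]
theorem matOf_coordAct {d e : V → ℕ} (F : Coord d e) (g : BlockAlg e) (i : V) :
    matOf (coordAct d e F g) i = matOf F i * g i := rfl

theorem coord_ext {d e : V → ℕ} {F F' : Coord d e} (h : ∀ i, matOf F i = matOf F' i) : F = F' :=
  (matEquiv d e).injective (funext h)

theorem matOf_injective_of_coordAct_injective {d e : V → ℕ} {F : Coord d e}
    (h : Function.Injective (coordAct d e F)) (i : V) :
    Function.Injective (matOf F i).mulVecLin := by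
  classical
  rw [← LinearMap.ker_eq_bot, LinearMap.ker_eq_bot']
  intro v hv
  have h0 : coordAct d e F (Pi.single i (Matrix.of fun p _ => v p)) = 0 := by
    apply coord_ext
    intro j
    rw [matOf_coordAct]
    by_cases hj : j = i
    · subst hj
      rw [Pi.single_eq_same]
      ext p k
      exact congrFun hv p
    · rw [Pi.single_eq_of_ne hj, Matrix.mul_zero]
      rfl
  have h1 := congrFun (h (h0.trans (map_zero _).symm)) i
  rw [Pi.single_eq_same] at h1
  funext p
  exact congrFun (congrFun h1 p) p

theorem coordAct_injective {d e : V → ℕ} {F : Coord d e}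
    (h : ∀ i, Function.Injective (matOf F i).mulVecLin) : Function.Injective (coordAct d e F) := by
  rw [← LinearMap.ker_eq_bot, LinearMap.ker_eq_bot']
  intro g hg
  funext i
  have h1 : matOf F i * g i = 0 := by
    rw [← matOf_coordAct, hg]
    rfl
  apply Matrix.toLin'.injective
  refine LinearMap.ext fun v => h i ?_
  rw [Pi.zero_apply, map_zero, LinearMap.zero_apply, map_zero, Matrix.toLin'_apply,
    Matrix.mulVecLin_apply, Matrix.mulVec_mulVec, h1, Matrix.zero_mulVec]

/-- The defect of a tuple of matrices to be a morphism of representations. -/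
def homDefect (s t : A → V) {d e : V → ℕ} (M : QRep s t d) (N : QRep s t e) :
    Coord d e →ₗ[ℂ] (∀ a : A, Matrix (Fin (d (t a))) (Fin (e (s a))) ℂ) where
  toFun F a := M a * matOf F (s a) - matOf F (t a) * N a
  map_add' F F' := by
    funext a
    change M a * (matOf F (s a) + matOf F' (s a)) - (matOf F (t a) + matOf F' (t a)) * N a = _
    rw [Matrix.mul_add, Matrix.add_mul]
    exact add_sub_add_comm _ _ _ _
  map_smul' c F := by
    funext a
    change M a * (c • matOf F (s a)) - (c • matOf F (t a)) * N a = _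
    rw [Matrix.mul_smul, Matrix.smul_mul, ← smul_sub]
    rfl

theorem homDefect_eq_zero_iff {s t : A → V} {d e : V → ℕ} {M : QRep s t d} {N : QRep s t e}
    {F : Coord d e} :
    homDefect s t M N F = 0 ↔ ∀ a, M a * matOf F (s a) = matOf F (t a) * N a := by
  rw [funext_iff]
  exact forall_congr' fun a => sub_eq_zero

theorem finrank_ker_homDefect (s t : A → V) {d e : V → ℕ} (M : QRep s t d) (N : QRep s t e) :
    Module.finrank ℂ (LinearMap.ker (homDefect s t M N)) =
      Module.finrank ℂ (homRepC s t N M) := by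
  have h : (LinearMap.ker (homDefect s t M N)).map (matEquiv d e : Coord d e →ₗ[ℂ] _) =
      homRepC s t N M := by
    ext f
    rw [Submodule.mem_map_equiv, LinearMap.mem_ker, homDefect_eq_zero_iff]
    rfl
  rw [← h, LinearEquiv.finrank_map_eq]

theorem homDefect_coordAct {s t : A → V} {d e : V → ℕ} {M : QRep s t d} {N : QRep s t e}
    {F : Coord d e} (hF : homDefect s t M N F = 0) {g : BlockAlg e} (hg : g ∈ homRepC s t N N) :
    homDefect s t M N (coordAct d e F g) = 0 := by
  rw [homDefect_eq_zero_iff] at hF ⊢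
  intro a
  rw [matOf_coordAct, matOf_coordAct, ← Matrix.mul_assoc, hF a, Matrix.mul_assoc, hg a,
    Matrix.mul_assoc]

theorem mem_homRepC_of_homDefect_coordAct {s t : A → V} {d e : V → ℕ} {M : QRep s t d}
    {N : QRep s t e} {F : Coord d e} (hF : homDefect s t M N F = 0)
    (hinj : ∀ i, Function.Injective (matOf F i).mulVecLin) {g : BlockAlg e}
    (hg : homDefect s t M N (coordAct d e F g) = 0) : g ∈ homRepC s t N N := by
  rw [homDefect_eq_zero_iff] at hF hg
  intro a
  have h := hg a
  rw [matOf_coordAct, matOf_coordAct, ← Matrix.mul_assoc, hF a, Matrix.mul_assoc,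
    Matrix.mul_assoc] at h
  apply Matrix.toLin'.injective
  refine LinearMap.ext fun v => hinj (t a) ?_
  simp only [Matrix.toLin'_apply, Matrix.mulVecLin_apply, Matrix.mulVec_mulVec, h]

/-! ### The quotient map onto the quiver Grassmannian -/

section Grassmannian

variable {s t : A → V} {d e : V → ℕ} {M : QRep s t d}

instance : TopologicalSpace (StQ s t M e) := TopologicalSpace.induced Subtype.val (zariski _)

theorem isInducing_stQ : IsInducing (fun F : StQ s t M e => ZariskiSpace.mk F.1) :=
  ⟨by
    change _ = TopologicalSpace.induced _ (TopologicalSpace.induced _ _)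
    rw [induced_compose]
    rfl⟩

theorem exists_unit_mul_eq {m n : ℕ} {P : Matrix (Fin m) (Fin n) ℂ}
    (hP : Function.Injective P.mulVecLin)
    (φ : (Fin n → ℂ) ≃ₗ[ℂ] LinearMap.range P.mulVecLin) :
    ∃ g : (Matrix (Fin n) (Fin n) ℂ)ˣ, ∀ v, (P * g.1) *ᵥ v = φ v := by
  let ψ : (Fin n → ℂ) ≃ₗ[ℂ] (Fin n → ℂ) := φ.trans (LinearEquiv.ofInjective _ hP).symm
  refine ⟨⟨LinearMap.toMatrix' ψ.toLinearMap, LinearMap.toMatrix' ψ.symm.toLinearMap, ?_, ?_⟩,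
    fun v => ?_⟩
  · rw [← LinearMap.toMatrix'_comp]
    simp
  · rw [← LinearMap.toMatrix'_comp]
    simp
  · rw [← Matrix.mulVec_mulVec, LinearMap.toMatrix'_mulVec]
    exact congrArg Subtype.val ((LinearEquiv.ofInjective _ hP).apply_symm_apply (φ v))

/-- The change of basis given by a unit. -/
def unitEquiv (u : (BlockAlg e)ˣ) (i : V) : (Fin (e i) → ℂ) ≃ₗ[ℂ] (Fin (e i) → ℂ) :=
  LinearEquiv.ofLinearMap (u.1 i).mulVecLin (u⁻¹.1 i).mulVecLin
    (by rw [← Matrix.mulVecLin_mul, ← Pi.mul_apply, u.mul_inv]; exact Matrix.mulVecLin_one)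
    (by rw [← Matrix.mulVecLin_mul, ← Pi.mul_apply, u.inv_mul]; exact Matrix.mulVecLin_one)

theorem exists_unit_coordAct_eq {F : Coord d e}
    (hF : ∀ i, Function.Injective (matOf F i).mulVecLin)
    (φ : ∀ i, (Fin (e i) → ℂ) ≃ₗ[ℂ] LinearMap.range (matOf F i).mulVecLin) :
    ∃ u : (BlockAlg e)ˣ, ∀ i v, matOf (coordAct d e F u) i *ᵥ v = φ i v := by
  choose g hg using fun i => exists_unit_mul_eq (hF i) (φ i)
  exact ⟨MulEquiv.piUnits.symm g, hg⟩

theorem toSub_eq_of_coordAct {F F' : StQ s t M e} {u : (BlockAlg e)ˣ}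
    (h : F'.1 = coordAct d e F.1 u) : toSub s t M e F' = toSub s t M e F := by
  refine Subtype.ext (funext fun i => ?_)
  change LinearMap.range (matOf F'.1 i).mulVecLin = LinearMap.range (matOf F.1 i).mulVecLin
  rw [h, matOf_coordAct, Matrix.mulVecLin_mul]
  refine LinearMap.range_comp_of_range_eq_top _ (LinearMap.range_eq_top.2 ?_)
  exact (unitEquiv u i).surjective

theorem exists_coordAct_of_toSub_eq {F F' : StQ s t M e}
    (h : toSub s t M e F' = toSub s t M e F) : ∃ u : (BlockAlg e)ˣ, F'.1 = coordAct d e F.1 u := by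
  have hr : ∀ i, LinearMap.range (matOf F'.1 i).mulVecLin =
      LinearMap.range (matOf F.1 i).mulVecLin := congrFun (congrArg Subtype.val h)
  obtain ⟨u, hu⟩ := exists_unit_coordAct_eq F.2.1 fun i =>
    (LinearEquiv.ofInjective _ (F'.2.1 i)).trans (LinearEquiv.ofEq _ _ (hr i))
  refine ⟨u, coord_ext fun i => Matrix.toLin'.injective (LinearMap.ext fun v => ?_)⟩
  rw [Matrix.toLin'_apply, Matrix.toLin'_apply, hu i v]
  rfl

theorem toSub_surjective : Function.Surjective (toSub s t M e) := by
  intro x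
  have φ : ∀ i, (Fin (e i) → ℂ) ≃ₗ[ℂ] x.1 i := fun i =>
    LinearEquiv.ofFinrankEq _ _ (by rw [x.2.1 i, Module.finrank_fin_fun])
  let F : Coord d e := (matEquiv d e).symm fun i =>
    LinearMap.toMatrix' ((x.1 i).subtype ∘ₗ (φ i).toLinearMap)
  have hF : ∀ i, (matOf F i).mulVecLin = (x.1 i).subtype ∘ₗ (φ i).toLinearMap := fun i =>
    LinearMap.ext fun v =>
      LinearMap.toMatrix'_mulVec ((x.1 i).subtype ∘ₗ (φ i).toLinearMap) v
  have hr : ∀ i, LinearMap.range (matOf F i).mulVecLin = x.1 i := fun i => by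
    rw [hF, LinearMap.range_comp, LinearEquiv.range, Submodule.map_top, Submodule.range_subtype]
  refine ⟨⟨F, fun i => ?_, fun a => ?_⟩, Subtype.ext (funext hr)⟩
  · rw [hF]
    exact Subtype.val_injective.comp (φ i).injective
  · rw [hr, hr]
    exact x.2.2 a

theorem isQuotientMap_toSub : IsQuotientMap (toSub s t M e) :=
  ⟨⟨rfl⟩, toSub_surjective⟩

theorem toSub_mem_strat_iff {N : QRep s t e} {F : StQ s t M e} :
    toSub s t M e F ∈ strat s t M N ↔
      ∃ u : (BlockAlg e)ˣ, homDefect s t M N (coordAct d e F.1 u) = 0 := by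
  constructor
  · rintro ⟨φ, hφ⟩
    obtain ⟨u, hu⟩ := exists_unit_coordAct_eq F.2.1 φ
    refine ⟨u, homDefect_eq_zero_iff.2 fun a =>
      Matrix.toLin'.injective (LinearMap.ext fun v => ?_)⟩
    rw [Matrix.toLin'_apply, Matrix.toLin'_apply, ← Matrix.mulVec_mulVec, ← Matrix.mulVec_mulVec,
      hu, hu]
    exact (hφ a v).symm
  · rintro ⟨u, hu⟩
    rw [homDefect_eq_zero_iff] at hu
    refine ⟨fun i => (unitEquiv u i).trans (LinearEquiv.ofInjective _ (F.2.1 i)), fun a v => ?_⟩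
    change matOf F.1 (t a) *ᵥ (u.1 (t a) *ᵥ (N a *ᵥ v)) =
      M a *ᵥ (matOf F.1 (s a) *ᵥ (u.1 (s a) *ᵥ v))
    have h := congrArg (· *ᵥ v) (hu a)
    simp only [matOf_coordAct] at h
    simp only [Matrix.mulVec_mulVec]
    rw [h, Matrix.mul_assoc]

/-- Injective morphisms of representations are points of the Stiefel variety. -/
def StQ.ofHom {N : QRep s t e} (F : Coord d e) (hF : homDefect s t M N F = 0)
    (hinj : ∀ i, Function.Injective (matOf F i).mulVecLin) : StQ s t M e :=
  ⟨F, hinj, fun a => by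
    rw [homDefect_eq_zero_iff] at hF
    rw [← LinearMap.range_comp, ← Matrix.mulVecLin_mul, hF a, Matrix.mulVecLin_mul]
    exact LinearMap.range_comp_le_range _ _⟩

theorem exists_ofHom_of_mem_strat {N : QRep s t e} {x : SubRep s t M e}
    (hx : x ∈ strat s t M N) : ∃ F : StQ s t M e, toSub s t M e F = x ∧
      homDefect s t M N F.1 = 0 := by
  obtain ⟨F, rfl⟩ := toSub_surjective x
  obtain ⟨u, hu⟩ := toSub_mem_strat_iff.1 hx
  refine ⟨StQ.ofHom _ hu fun i => ?_, toSub_eq_of_coordAct rfl, hu⟩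
  rw [matOf_coordAct, Matrix.mulVecLin_mul]
  exact (F.2.1 i).comp (unitEquiv u i).injective

end Grassmannian


/-! ### Charts of the stratum -/

section Charts

variable {s t : A → V} {d e : V → ℕ}

/-- Slices for the action of changes of basis on tuples of matrices, together with a linear
projection onto the endomorphisms of `N`. -/
structure StratSlice (M : QRep s t d) (N : QRep s t e) extends
    SliceDatum (Σ i : V, Fin (d i) × Fin (e i)) (BlockAlg e)
      ((∀ a : A, Matrix (Fin (d (t a))) (Fin (e (s a))) ℂ) × homRepC s t N N) where
  /-- the projection onto the endomorphisms of `N` -/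
  q : Coord d e →ₗ[ℂ] homRepC s t N N
  act_eq : act = coordAct d e
  β_eq : β = (homDefect s t M N).prod q
  one_mem : 1 ∈ homRepC s t N N
  b_eq : b = (0, ⟨1, one_mem⟩)
  /-- the base point -/
  F₀ : Coord d e
  q_act : ∀ g : homRepC s t N N, q (coordAct d e F₀ g) = g
  isUnit_system : IsUnit (toSliceDatum.system F₀)
  β_F₀ : β F₀ = b

variable {M : QRep s t d} {N : QRep s t e}

namespace StratSlice

variable (S : StratSlice M N)

theorem homDefect_eq_zero {F : Coord d e} (h : S.β F = S.b) : homDefect s t M N F = 0 := by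
  rw [S.β_eq, S.b_eq] at h
  exact (Prod.ext_iff.1 h).1

theorem finrank_ker_add [Finite V] : Module.finrank ℂ (LinearMap.ker S.β) +
    Module.finrank ℂ (homRepC s t N N) = Module.finrank ℂ (homRepC s t N M) := by
  rw [S.β_eq, ← finrank_ker_homDefect s t M N]
  exact finrank_ker_prod_add _ _ fun g =>
    ⟨_, homDefect_coordAct (S.homDefect_eq_zero S.β_F₀) g.2, S.q_act g⟩

theorem injective_of_isUnit_system {F : Coord d e} (h : IsUnit (S.system F)) (i : V) :
    Function.Injective (matOf F i).mulVecLin := by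
  refine matOf_injective_of_coordAct_injective ?_ i
  rw [← S.act_eq]
  exact SliceDatum.act_injective h

/-- The locus of the quiver Grassmannian covered by the slice. -/
def chart : Set (SubRep s t M e) := {x | ∃ F : StQ s t M e, toSub s t M e F = x ∧ F.1 ∈ S.domain}

theorem toSub_mem_chart_iff {F : StQ s t M e} : toSub s t M e F ∈ S.chart ↔ F.1 ∈ S.domain := by
  refine ⟨fun ⟨F', h, hF'⟩ => ?_, fun h => ⟨F, rfl, h⟩⟩
  obtain ⟨u, hu⟩ := exists_coordAct_of_toSub_eq h.symm
  rw [hu, ← S.act_eq]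
  exact SliceDatum.act_mem_domain hF' u

/-- The normalized matrices of a point of the chart. -/
def normalForm (x : SubRep s t M e) : Coord d e :=
  S.normalize (Function.surjInv toSub_surjective x).1

theorem normalForm_toSub {F : StQ s t M e} (hF : F.1 ∈ S.domain) :
    S.normalForm (toSub s t M e F) = S.normalize F.1 := by
  obtain ⟨u, hu⟩ := exists_coordAct_of_toSub_eq
    (Function.surjInv_eq toSub_surjective (toSub s t M e F))
  rw [normalForm, hu, ← S.act_eq]
  exact SliceDatum.normalize_act hF u

theorem normalForm_mem_domain {x : SubRep s t M e} (hx : x ∈ S.chart) :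
    S.normalForm x ∈ S.domain := by
  obtain ⟨F, rfl, hF⟩ := hx
  rw [S.normalForm_toSub hF]
  obtain ⟨u, hu⟩ := SliceDatum.exists_unit_act_eq_normalize hF
  rw [← hu]
  exact SliceDatum.act_mem_domain hF u

theorem toSub_eq_of_eq_normalForm {x : SubRep s t M e} (hx : x ∈ S.chart) {F : StQ s t M e}
    (h : F.1 = S.normalForm x) : toSub s t M e F = x := by
  obtain ⟨F', rfl, hF'⟩ := hx
  rw [S.normalForm_toSub hF'] at h
  obtain ⟨u, hu⟩ := SliceDatum.exists_unit_act_eq_normalize hF'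
  rw [← hu, S.act_eq] at h
  exact toSub_eq_of_coordAct h

variable [Finite V]

theorem isOpen_chart : IsOpen S.chart := by
  rw [← isQuotientMap_toSub.isOpen_preimage]
  convert S.isOpen_domain.preimage isInducing_stQ.continuous using 1
  ext F
  exact S.toSub_mem_chart_iff

theorem toSub_mem_strat_iff {F : StQ s t M e} (hF : F.1 ∈ S.domain) :
    toSub s t M e F ∈ strat s t M N ↔ S.β (S.normalize F.1) = S.b := by
  rw [_root_.toSub_mem_strat_iff, ← S.act_eq]
  refine exists_unit_iff_normalize S.one_mem S.β_eq S.b_eq (fun F hF g hg => ?_) hF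
  rw [S.act_eq]
  exact homDefect_coordAct hF hg

theorem isOpen_chart_diff_strat : IsOpen (S.chart \ strat s t M N) := by
  rw [← isQuotientMap_toSub.isOpen_preimage]
  convert S.isOpen_normalize_ne.preimage isInducing_stQ.continuous using 1
  ext F
  simp only [Set.mem_preimage, Set.mem_sdiff, S.toSub_mem_chart_iff, Set.mem_ofPred_eq]
  exact and_congr_right fun hF => not_congr (S.toSub_mem_strat_iff hF)

theorem chart_inter_closure_subset :
    S.chart ∩ closure (strat s t M N) ⊆ strat s t M N := by
  rintro x ⟨hx, hc⟩
  by_contra h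
  obtain ⟨y, hy, hys⟩ := mem_closure_iff.1 hc _ S.isOpen_chart_diff_strat ⟨hx, h⟩
  exact hy.2 hys

theorem β_normalForm {x : SubRep s t M e} (hx : x ∈ S.chart) (hs : x ∈ strat s t M N) :
    S.β (S.normalForm x) = S.b := by
  obtain ⟨F, rfl, hF⟩ := hx
  rw [S.normalForm_toSub hF]
  exact (S.toSub_mem_strat_iff hF).1 hs

theorem continuousOn_affine_normalForm {τ : Type} (l : Coord d e →ₗ[ℂ] (τ → ℂ)) (c : Coord d e) :
    ContinuousOn (fun x => ZariskiSpace.mk (l (S.normalForm x - c))) S.chart := by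
  rw [isQuotientMap_toSub.continuousOn_isOpen_iff S.isOpen_chart]
  refine ((S.continuousOn_affine_normalize l c).comp isInducing_stQ.continuous.continuousOn
    (fun F hF => S.toSub_mem_chart_iff.1 hF)).congr fun F hF => ?_
  change ZariskiSpace.mk (l (S.normalForm (toSub s t M e F) - c)) = _
  rw [S.normalForm_toSub (S.toSub_mem_chart_iff.1 hF)]
  rfl

/-- The part of the stratum in a chart is an open subset of an affine space. -/
theorem nonempty_homeomorph {r : ℕ} {κ : (Fin r → ℂ) →ₗ[ℂ] Coord d e}
    {ρ : Coord d e →ₗ[ℂ] (Fin r → ℂ)} (hκ : ∀ z, S.β (κ z) = 0) (hρκ : ∀ z, ρ (κ z) = z)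
    (hκρ : ∀ w, S.β w = 0 → κ (ρ w) = w) :
    Nonempty ((Subtype.val ⁻¹' S.chart : Set (strat s t M N)) ≃ₜ
      {z : ZariskiSpace (Fin r) | S.F₀ + κ z.coords ∈ S.domain}) := by
  have hβ : ∀ z, S.β (S.F₀ + κ z) = S.b := fun z => by rw [map_add, hκ, add_zero, S.β_F₀]
  have key : ∀ x ∈ S.chart, x ∈ strat s t M N →
      S.F₀ + κ (ρ (S.normalForm x - S.F₀)) = S.normalForm x := fun x hx hs => by
    rw [hκρ _ (by rw [map_sub, S.β_normalForm hx hs, S.β_F₀, sub_self]), add_sub_cancel]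
  let point : {z : ZariskiSpace (Fin r) | S.F₀ + κ z.coords ∈ S.domain} → StQ s t M e := fun z =>
    StQ.ofHom (S.F₀ + κ z.1.coords) (S.homDefect_eq_zero (hβ _))
      (S.injective_of_isUnit_system z.2.1)
  have hn : ∀ z, S.normalForm (toSub s t M e (point z)) = S.F₀ + κ z.1.coords := fun z => by
    rw [S.normalForm_toSub (F := point z) z.2]
    exact SliceDatum.normalize_of_slice z.2.1 (hβ _)
  have hchart : ∀ z, toSub s t M e (point z) ∈ S.chart := fun z => S.toSub_mem_chart_iff.2 z.2
  have hstrat : ∀ z, toSub s t M e (point z) ∈ strat s t M N := fun z => by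
    rw [S.toSub_mem_strat_iff (F := point z) z.2]
    exact (congrArg S.β (SliceDatum.normalize_of_slice z.2.1 (hβ _))).trans (hβ _)
  have hpoint : Continuous point := by
    rw [isInducing_stQ.continuous_iff]
    refine regularFunctions.continuous_of_coord_mem
      (ι := fun z : {z : ZariskiSpace (Fin r) | S.F₀ + κ z.coords ∈ S.domain} => z.1.coords)
      continuous_subtype_val fun j => ?_
    exact (regularFunctions _).add_mem (regularFunctions.const_mem (S.F₀ j))
      (regularFunctions.linear_mem (LinearMap.proj j ∘ₗ κ))
  refine ⟨⟨⟨fun x => ⟨⟨ρ (S.normalForm x.1.1 - S.F₀)⟩, ?_⟩,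
    fun z => ⟨⟨toSub s t M e (point z), hstrat z⟩, hchart z⟩, fun x => ?_, fun z => ?_⟩, ?_, ?_⟩⟩
  · rw [Set.mem_ofPred_eq, key _ x.2 x.1.2]
    exact S.normalForm_mem_domain x.2
  · exact Subtype.ext (Subtype.ext (S.toSub_eq_of_eq_normalForm x.2 (key _ x.2 x.1.2)))
  · refine Subtype.ext (ZariskiSpace.ext ?_)
    change ρ (S.normalForm (toSub s t M e (point z)) - S.F₀) = _
    rw [hn, add_sub_cancel_left, hρκ]
  · exact Continuous.subtype_mk ((S.continuousOn_affine_normalForm ρ S.F₀).comp_continuous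
      (continuous_subtype_val.comp continuous_subtype_val) fun x => x.2) _
  · exact ((isQuotientMap_toSub.continuous.comp hpoint).subtype_mk _).subtype_mk _

theorem isOpen_affine_preimage_domain {r : ℕ} (κ : (Fin r → ℂ) →ₗ[ℂ] Coord d e) :
    IsOpen {z : ZariskiSpace (Fin r) | S.F₀ + κ z.coords ∈ S.domain} := by
  have h : Continuous (fun z : ZariskiSpace (Fin r) => ZariskiSpace.mk (S.F₀ + κ z.coords)) :=
    regularFunctions.continuous_of_coord_mem (ι := ZariskiSpace.coords) continuous_id fun j =>
      (regularFunctions _).add_mem (regularFunctions.const_mem (S.F₀ j))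
        (regularFunctions.linear_mem (LinearMap.proj j ∘ₗ κ))
  exact S.isOpen_domain.preimage h

theorem exists_homeomorph {r : ℕ} (hr : Module.finrank ℂ (LinearMap.ker S.β) = r) :
    ∃ O : Set (ZariskiSpace (Fin r)), IsOpen O ∧
      Nonempty ((Subtype.val ⁻¹' S.chart : Set (strat s t M N)) ≃ₜ O) := by
  let ε : (Fin r → ℂ) ≃ₗ[ℂ] LinearMap.ker S.β :=
    LinearEquiv.ofFinrankEq _ _ (by rw [hr, Module.finrank_fin_fun])
  obtain ⟨p, hp⟩ := (LinearMap.ker S.β).subtype.exists_leftInverse_of_injective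
    (Submodule.ker_subtype _)
  refine ⟨_, S.isOpen_affine_preimage_domain ((LinearMap.ker S.β).subtype ∘ₗ ε.toLinearMap),
    S.nonempty_homeomorph (ρ := ε.symm.toLinearMap ∘ₗ p) (fun z => (ε z).2) (fun z => ?_)
      fun w hw => ?_⟩
  · exact (congrArg ε.symm (LinearMap.congr_fun hp (ε z))).trans (ε.symm_apply_apply z)
  · have h : p w = ⟨w, hw⟩ := LinearMap.congr_fun hp ⟨w, hw⟩
    exact (congrArg Subtype.val (ε.apply_symm_apply (p w))).trans (congrArg Subtype.val h)

end StratSlice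

theorem exists_stratSlice_mem_chart {x : SubRep s t M e} (hx : x ∈ strat s t M N) :
    ∃ S : StratSlice M N, x ∈ S.chart := by
  obtain ⟨F, hFx, hF⟩ := exists_ofHom_of_mem_strat hx
  have h1 : (1 : BlockAlg e) ∈ homRepC s t N N := fun a => by
    rw [Pi.one_apply, Pi.one_apply, Matrix.mul_one, Matrix.one_mul]
  obtain ⟨S, q, ha, hβ, hb, hq, hu, hS⟩ := exists_sliceDatum (coordAct d e)
    (fun F => coord_ext fun i => Matrix.mul_one (matOf F i))
    (fun F g h => coord_ext fun i => Matrix.mul_assoc (matOf F i) (g i) (h i)) (homDefect s t M N)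
    (homRepC s t N N) h1 F.1 hF (coordAct_injective F.2.1)
    (fun g => mem_homRepC_of_homDefect_coordAct hF F.2.1)
  exact ⟨⟨S, q, ha, hβ, h1, hb, F.1, hq, hu, hS⟩, F, hFx, SliceDatum.mem_domain_of_slice hu hS⟩

end Charts

/-- The stratum `S_{[N]} ⊆ Gr_e(M)` is locally closed of dimension
`dim Hom_Q(N,M) − dim Hom_Q(N,N)`. -/
theorem strat_locallyClosed_dim [Fintype V] [Fintype A] (s t : A → V)
    (hQ : IsDynkin s t) (d e : V → ℕ)
    (M : QRep s t d) (N : QRep s t e)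
    (hne : (strat s t M N).Nonempty) :
    IsLocallyClosed (strat s t M N) ∧
    topologicalKrullDim (strat s t M N) +
        ((Module.finrank ℂ (homRepC s t N N) : ℕ∞) : WithBot ℕ∞) =
      ((Module.finrank ℂ (homRepC s t N M) : ℕ∞) : WithBot ℕ∞) := by
  have hS := fun x (hx : x ∈ strat s t M N) => exists_stratSlice_mem_chart hx
  refine ⟨((isLocallyClosed_tfae _).out 0 3).2 fun x hx => ?_, ?_⟩
  · obtain ⟨S, hxS⟩ := hS x hx
    exact ⟨S.chart, hxS, S.isOpen_chart, S.chart_inter_closure_subset⟩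
  · obtain ⟨S₀, -⟩ := hS _ hne.some_mem
    have : Nonempty (strat s t M N) := hne.to_subtype
    rw [topologicalKrullDim_of_locally_affine (Module.finrank ℂ (LinearMap.ker S₀.β))]
    · exact_mod_cast S₀.finrank_ker_add
    · intro x
      obtain ⟨S, hxS⟩ := hS x x.2
      refine ⟨_, S.isOpen_chart.preimage continuous_subtype_val, hxS, S.exists_homeomorph ?_⟩
      exact Nat.add_right_cancel (S.finrank_ker_add.trans S₀.finrank_ker_add.symm)

end
end

section
/- Let Q be a Dynkin quiver and d a dimension vector. A representation M of dimension vector d has dense G_d-orbit in the representation variety R_d if and only if Ext¹_Q(M,M) = 0, i.e. M is rigid. Consequently, the codimension of the orbit of any M in R_d equals dim Ext¹_Q(M,M). -/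
/-!
STATEMENT 7: Let Q be a Dynkin quiver and d a dimension vector.  A representation M
of dimension vector d has dense `G_d`-orbit in the representation variety `R_d`
(with its Zariski topology) if and only if `Ext¹_Q(M,M) = 0`, i.e. M is rigid.
Consequently, the codimension of the orbit of any M in `R_d` equals
`dim Ext¹_Q(M,M)`: `dim (orbit) + dim Ext¹(M,M) = dim R_d`.

`Ext¹(M,M)` is computed as the cokernel of the map `Φ^M_M` (standard resolution over
the path algebra); a quiver is Dynkin iff its Tits form is positive definite.
-/

noncomputable section
open Matrix

variable {V A : Type}

/-- The Zariski topology on the representation variety `R_d`. -/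
def zarRep (s t : A → V) (d : V → ℕ) : TopologicalSpace (QRep s t d) :=
  TopologicalSpace.induced
    (fun M => fun x : Σ a : A, Fin (d (t a)) × Fin (d (s a)) => M x.1 x.2.1 x.2.2)
    (zariski _)

/-- The base-change action of `G_d = Π_i GL_{d i}(ℂ)` on `R_d`. -/
def act (s t : A → V) {d : V → ℕ}
    (g : ∀ i : V, Matrix.GeneralLinearGroup (Fin (d i)) ℂ) (M : QRep s t d) :
    QRep s t d :=
  fun a => (g (t a) : Matrix (Fin (d (t a))) (Fin (d (t a))) ℂ) * M a *
    (((g (s a))⁻¹ : Matrix.GeneralLinearGroup (Fin (d (s a))) ℂ) :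
      Matrix (Fin (d (s a))) (Fin (d (s a))) ℂ)

/-- The `G_d`-orbit of `M` in `R_d`. -/
def orbit (s t : A → V) {d : V → ℕ} (M : QRep s t d) : Set (QRep s t d) :=
  {M' | ∃ g, M' = act s t g M}

/-- The map `Φ^M_N` as a linear map. -/
def PhiL (s t : A → V) {e d : V → ℕ} (N : QRep s t e) (M : QRep s t d) :
    (∀ i : V, Matrix (Fin (d i)) (Fin (e i)) ℂ) →ₗ[ℂ]
      (∀ a : A, Matrix (Fin (d (t a))) (Fin (e (s a))) ℂ) where
  toFun f := fun a => M a * f (s a) - f (t a) * N a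
  map_add' f g := by
    funext a
    simp only [Pi.add_apply, Matrix.mul_add, Matrix.add_mul]
    abel
  map_smul' c f := by
    funext a
    simp only [Pi.smul_apply, Matrix.mul_smul, Matrix.smul_mul, smul_sub, RingHom.id_apply]
open MvPolynomial Topology

/-- The point of the prime spectrum of the polynomial ring attached to a point of affine space. -/
def specPoint {σ : Type} (x : σ → ℂ) : PrimeSpectrum (MvPolynomial σ ℂ) :=
  ⟨RingHom.ker (MvPolynomial.eval x), RingHom.ker_isPrime _⟩

section Away

variable {τ : Type} {D : MvPolynomial τ ℂ}

/-- Evaluation of a rational function with denominator a power of `D` at a point of `D ≠ 0`. -/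
def evalAway (D : MvPolynomial τ ℂ) (x : {x : τ → ℂ // eval x D ≠ 0}) :
    Localization.Away D →+* ℂ :=
  IsLocalization.Away.lift D (g := eval x.1) x.2.isUnit

@[simp]
lemma evalAway_algebraMap (x : {x : τ → ℂ // eval x D ≠ 0}) (p : MvPolynomial τ ℂ) :
    evalAway D x (algebraMap _ _ p) = eval x.1 p :=
  IsLocalization.Away.lift_eq D _ p

lemma evalAway_ne_zero_iff_of_mul_eq {x : {x : τ → ℂ // eval x D ≠ 0}} {b : Localization.Away D}
    {n : ℕ} {p : MvPolynomial τ ℂ} (h : b * algebraMap _ _ (D ^ n) = algebraMap _ _ p) :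
    evalAway D x b ≠ 0 ↔ eval x.1 p ≠ 0 := by
  have := congrArg (evalAway D x) h
  simp only [map_mul, evalAway_algebraMap, map_pow] at this
  rw [← this]
  simp [x.2]

lemma exists_evalAway_mul_ne_zero {b₁ b₂ : Localization.Away D}
    (h₁ : ∃ x, evalAway D x b₁ ≠ 0) (h₂ : ∃ x, evalAway D x b₂ ≠ 0) :
    ∃ x, evalAway D x (b₁ * b₂) ≠ 0 := by
  obtain ⟨x₁, h₁⟩ := h₁
  obtain ⟨x₂, h₂⟩ := h₂
  obtain ⟨n₁, p₁, e₁⟩ := IsLocalization.Away.surj D b₁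
  obtain ⟨n₂, p₂, e₂⟩ := IsLocalization.Away.surj D b₂
  rw [← map_pow] at e₁ e₂
  have q₁ : p₁ ≠ 0 := by
    rintro rfl; exact (evalAway_ne_zero_iff_of_mul_eq e₁).1 h₁ (map_zero _)
  have q₂ : p₂ ≠ 0 := by
    rintro rfl; exact (evalAway_ne_zero_iff_of_mul_eq e₂).1 h₂ (map_zero _)
  have qD : D ≠ 0 := by
    rintro rfl; exact x₁.2 (map_zero _)
  obtain ⟨x, hx⟩ : ∃ x, eval x (D * (p₁ * p₂)) ≠ 0 := by
    by_contra! h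
    exact mul_ne_zero qD (mul_ne_zero q₁ q₂) (MvPolynomial.funext fun x => by rw [h, map_zero])
  simp only [map_mul, mul_ne_zero_iff] at hx
  refine ⟨⟨x, hx.1⟩, ?_⟩
  rw [map_mul]
  exact mul_ne_zero ((evalAway_ne_zero_iff_of_mul_eq e₁).2 hx.2.1)
    ((evalAway_ne_zero_iff_of_mul_eq e₂).2 hx.2.2)

lemma exists_evalAway_ne_zero_and_eval_ne_zero {b : Localization.Away D}
    (hb : ∃ x, evalAway D x b ≠ 0) {q : MvPolynomial τ ℂ} (hq : q ≠ 0) :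
    ∃ x, evalAway D x b ≠ 0 ∧ eval x.1 q ≠ 0 := by
  have hD : D ≠ 0 := by
    obtain ⟨x, -⟩ := hb
    rintro rfl; exact x.2 (map_zero _)
  obtain ⟨y, hy⟩ : ∃ y, eval y (D * q) ≠ 0 := by
    by_contra! h
    exact mul_ne_zero hD hq (MvPolynomial.funext fun x => by rw [h, map_zero])
  simp only [map_mul, mul_ne_zero_iff] at hy
  obtain ⟨x, hx⟩ := exists_evalAway_mul_ne_zero hb
    (b₂ := algebraMap _ (Localization.Away D) q) ⟨⟨y, hy.1⟩, by simpa using hy.2⟩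
  rw [map_mul, mul_ne_zero_iff, evalAway_algebraMap] at hx
  exact ⟨x, hx⟩

lemma evalAway_aeval {σ : Type} (x : {x : τ → ℂ // eval x D ≠ 0})
    (b : σ → Localization.Away D) (c : σ → ℂ) (h : ∀ i, evalAway D x (b i) = c i)
    (F : MvPolynomial σ ℂ) : evalAway D x (aeval b F) = eval c F := by
  have : (evalAway D x).comp (aeval b : MvPolynomial σ ℂ →ₐ[ℂ] _).toRingHom = eval c := by
    refine MvPolynomial.ringHom_ext (fun a => ?_) fun i => ?_
    · simp [IsScalarTower.algebraMap_apply ℂ (MvPolynomial τ ℂ) (Localization.Away D)]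
    · simp [h]
  exact RingHom.congr_fun this F

lemma trdeg_away_of_ne_zero {r : ℕ} {D : MvPolynomial (Fin r) ℂ} (hD : D ≠ 0) :
    Algebra.trdeg ℂ (Localization.Away D) = r := by
  have hle : Submonoid.powers D ≤ nonZeroDivisors (MvPolynomial (Fin r) ℂ) :=
    powers_le_nonZeroDivisors_of_noZeroDivisors hD
  have : IsDomain (Localization.Away D) := IsLocalization.isDomain_localization hle
  have : FaithfulSMul (MvPolynomial (Fin r) ℂ) (Localization.Away D) :=
    (faithfulSMul_iff_algebraMap_injective _ _).2 (IsLocalization.injective _ hle)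
  have : Algebra.IsAlgebraic (MvPolynomial (Fin r) ℂ) (Localization.Away D) :=
    IsLocalization.isAlgebraic _ (Submonoid.powers D)
  have h := trdeg_add_eq ℂ (MvPolynomial (Fin r) ℂ) (A := Localization.Away D)
  rw [trdeg_eq_zero (R := MvPolynomial (Fin r) ℂ), add_zero] at h
  rw [← h]
  simp

end Away

lemma ringKrullDim_le_of_isIntegral {R S : Type} [CommRing R] [CommRing S] {f : R →+* S}
    (hf : f.IsIntegral) : ringKrullDim S ≤ ringKrullDim R := by
  algebraize [f]
  refine Order.krullDim_le_of_strictMono (PrimeSpectrum.comap (algebraMap R S)) fun p q h => ?_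
  exact Ideal.IsIntegral.comap_lt_comap h

/-- The image of an affine algebra in a localization of `ℂ[x₁, …, xᵣ]` has dimension at most `r`. -/
lemma ringKrullDim_quotient_ker_le {σ : Type} [Finite σ] {r : ℕ} {D : MvPolynomial (Fin r) ℂ}
    (hD : D ≠ 0) (θ : MvPolynomial σ ℂ →ₐ[ℂ] Localization.Away D) :
    ringKrullDim (MvPolynomial σ ℂ ⧸ RingHom.ker θ) ≤ r := by
  have hle : Submonoid.powers D ≤ nonZeroDivisors (MvPolynomial (Fin r) ℂ) :=
    powers_le_nonZeroDivisors_of_noZeroDivisors hD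
  have : IsDomain (Localization.Away D) := IsLocalization.isDomain_localization hle
  have : (RingHom.ker θ).IsPrime := RingHom.ker_isPrime θ
  obtain ⟨s, g, hg, hint⟩ :=
    exists_integral_inj_algHom_of_fg ℂ (MvPolynomial σ ℂ ⧸ RingHom.ker θ)
  refine (ringKrullDim_le_of_isIntegral hint).trans ?_
  have hinj : Function.Injective ((Ideal.kerLiftAlg θ).comp g) :=
    (Ideal.kerLiftAlg_injective θ).comp hg
  have h := trdeg_le_of_injective _ hinj
  rw [trdeg_away_of_ne_zero hD] at h
  have hs : s ≤ r := by simpa using h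
  simpa using hs

section Inducing

variable {X σ : Type} [TopologicalSpace X] {e : X → σ → ℂ}

lemma topologicalKrullDim_le_of_vanishing (he : IsInducing fun x => specPoint (e x))
    (I : Ideal (MvPolynomial σ ℂ)) (hI : ∀ F ∈ I, ∀ x, eval (e x) F = 0) :
    topologicalKrullDim X ≤ ringKrullDim (MvPolynomial σ ℂ ⧸ I) := by
  rw [← PrimeSpectrum.topologicalKrullDim_eq_ringKrullDim]
  have hemb := PrimeSpectrum.isClosedEmbedding_comap_of_surjective _
    (Ideal.Quotient.mk I) Ideal.Quotient.mk_surjective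
  have hmem : ∀ x, specPoint (e x) ∈
      Set.range (PrimeSpectrum.comap (Ideal.Quotient.mk I)) := by
    intro x
    rw [range_comap_of_surjective _ _ Ideal.Quotient.mk_surjective,
      PrimeSpectrum.mem_zeroLocus, Ideal.mk_ker]
    exact fun F hF => hI F hF x
  choose f hf using hmem
  have : IsInducing f := by
    refine IsInducing.of_comp_iff hemb.isInducing |>.1 ?_
    convert he using 1
    exact _root_.funext hf
  exact this.topologicalKrullDim_le

lemma topologicalKrullDim_le_of_rational [Finite σ] (he : IsInducing fun x => specPoint (e x))
    {r : ℕ} {D : MvPolynomial (Fin r) ℂ} (hD : D ≠ 0)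
    (θ : MvPolynomial σ ℂ →ₐ[ℂ] Localization.Away D)
    (hθ : ∀ F, θ F = 0 → ∀ x, eval (e x) F = 0) :
    topologicalKrullDim X ≤ r :=
  (topologicalKrullDim_le_of_vanishing he _ hθ).trans (ringKrullDim_quotient_ker_le hD θ)

lemma isOpen_eval_ne_zero (he : IsInducing fun x => specPoint (e x)) (F : MvPolynomial σ ℂ) :
    IsOpen {x | eval (e x) F ≠ 0} :=
  (PrimeSpectrum.basicOpen F).isOpen.preimage he.continuous

lemma isClosed_eval_eq_zero (he : IsInducing fun x => specPoint (e x)) (F : MvPolynomial σ ℂ) :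
    IsClosed {x | eval (e x) F = 0} := by
  rw [← isOpen_compl_iff]
  exact isOpen_eval_ne_zero he F

lemma exists_eval_ne_zero_of_mem_isOpen (he : IsInducing fun x => specPoint (e x))
    {U : Set X} (hU : IsOpen U) {x : X} (hx : x ∈ U) :
    ∃ F : MvPolynomial σ ℂ, eval (e x) F ≠ 0 ∧ ∀ y, eval (e y) F ≠ 0 → y ∈ U := by
  obtain ⟨W, hW, rfl⟩ := he.isOpen_iff.1 hU
  obtain ⟨_, ⟨F, rfl⟩, hxF, hF⟩ :=
    PrimeSpectrum.isTopologicalBasis_basic_opens.exists_subset_of_mem_open hx hW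
  exact ⟨F, hxF, fun y hy => hF hy⟩

/-- The image of a rational map from a nonempty principal open subset of affine space is
irreducible. -/
lemma isIrreducible_range_of_rational (he : IsInducing fun x => specPoint (e x))
    {τ : Type} {D : MvPolynomial τ ℂ} (θ : MvPolynomial σ ℂ →ₐ[ℂ] Localization.Away D)
    (f : {x : τ → ℂ // eval x D ≠ 0} → X)
    (hf : ∀ x F, evalAway D x (θ F) = eval (e (f x)) F) (hD : ∃ x, eval x D ≠ 0) :
    IsIrreducible (Set.range f) := by
  refine ⟨?_, ?_⟩
  · obtain ⟨x, hx⟩ := hD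
    exact ⟨_, ⟨x, hx⟩, rfl⟩
  · rintro U W hU hW ⟨_, ⟨x, rfl⟩, hxU⟩ ⟨_, ⟨y, rfl⟩, hyW⟩
    obtain ⟨F, hxF, hF⟩ := exists_eval_ne_zero_of_mem_isOpen he hU hxU
    obtain ⟨G, hyG, hG⟩ := exists_eval_ne_zero_of_mem_isOpen he hW hyW
    obtain ⟨z, hz⟩ := exists_evalAway_mul_ne_zero (D := D) (b₁ := θ F) (b₂ := θ G)
      ⟨x, by rwa [hf]⟩ ⟨y, by rwa [hf]⟩
    rw [map_mul, hf, hf] at hz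
    exact ⟨f z, ⟨z, rfl⟩, hF _ (left_ne_zero_of_mul hz), hG _ (right_ne_zero_of_mul hz)⟩

lemma le_topologicalKrullDim_of_chain (he : IsInducing fun x => specPoint (e x)) {r : ℕ}
    (Z : ℕ → Set X) (hZ : ∀ k ≤ r, IsIrreducible (Z k)) (hmono : ∀ k < r, Z k ⊆ Z (k + 1))
    (hP : ∀ k < r, ∃ P : MvPolynomial σ ℂ, (∀ z ∈ Z k, eval (e z) P = 0) ∧
      ∃ z ∈ Z (k + 1), eval (e z) P ≠ 0) :
    (r : WithBot ℕ∞) ≤ topologicalKrullDim X := by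
  let C : Fin (r + 1) → TopologicalSpace.IrreducibleCloseds X := fun k =>
    ⟨closure (Z k), (hZ k (Nat.lt_succ_iff.1 k.2)).closure, isClosed_closure⟩
  have hC : ∀ i : Fin r, C i.castSucc < C i.succ := by
    intro i
    obtain ⟨P, hP0, z, hz, hPz⟩ := hP i i.2
    refine lt_of_le_of_ne (closure_mono (hmono i i.2)) fun h => hPz ?_
    have hz' : z ∈ closure (Z i) := by
      have : z ∈ C i.succ := subset_closure hz
      rw [← h] at this
      exact this
    exact closure_minimal hP0 (isClosed_eval_eq_zero he P) hz'
  exact Order.LTSeries.length_le_krullDim (LTSeries.mk r C (Fin.strictMono_iff_lt_succ.2 hC))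

lemma topologicalKrullDim_eq_card [Fintype σ] (he : IsInducing fun x => specPoint (e x))
    (hb : Function.Bijective e) : topologicalKrullDim X = Fintype.card σ := by
  refine le_antisymm ?_ ?_
  · refine he.topologicalKrullDim_le.trans ?_
    rw [PrimeSpectrum.topologicalKrullDim_eq_ringKrullDim]
    simp
  · let v := Fintype.equivFin σ
    refine le_topologicalKrullDim_of_chain he
      (fun k => {x | ∀ i, k ≤ v i → e x i = 0}) (fun k _ => ?_)
      (fun k _ x hx i hi => hx i (by lia)) fun k hk => ?_
    · let c : (σ → ℂ) → σ → ℂ := fun y i => if k ≤ v i then 0 else y i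
      choose f hf using fun y : {y : σ → ℂ // eval y (1 : MvPolynomial σ ℂ) ≠ 0} =>
        hb.2 (c y.1)
      convert isIrreducible_range_of_rational he
        (aeval fun i => if k ≤ v i then 0 else
          algebraMap (MvPolynomial σ ℂ) (Localization.Away (1 : MvPolynomial σ ℂ))
            (MvPolynomial.X i)) f
        (fun y F => evalAway_aeval _ _ _ (fun i => ?_) F) ⟨0, by simp⟩
      · ext x
        refine ⟨fun hx => ⟨⟨e x, by simp⟩, hb.1 ?_⟩, ?_⟩
        · rw [hf]
          ext i
          by_cases hi : k ≤ v i
          · simp [c, hi, hx i hi]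
          · simp [c, hi]
        · rintro ⟨y, rfl⟩ i hi
          rw [hf]
          simp [c, hi]
      · rw [hf]
        by_cases hi : k ≤ v i <;> simp [c, hi]
    · refine ⟨MvPolynomial.X (v.symm ⟨k, hk⟩),
        fun z hz => by simpa using hz (v.symm ⟨k, hk⟩) (by simp), ?_⟩
      obtain ⟨z, hz⟩ := hb.2 fun i => if v i = k then 1 else 0
      exact ⟨z, fun i hi => by simp [hz]; lia, by simp [hz]⟩

/-- A subset of affine space is Zariski dense iff every polynomial vanishing on it is zero. -/
lemma dense_iff_forall_eval_eq_zero (he : IsInducing fun x => specPoint (e x))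
    (hs : Function.Surjective e) (S : Set X) :
    Dense S ↔ ∀ F : MvPolynomial σ ℂ, (∀ x ∈ S, eval (e x) F = 0) → F = 0 := by
  refine ⟨fun h F hF => MvPolynomial.funext fun y => ?_, fun h x => ?_⟩
  · obtain ⟨x, rfl⟩ := hs y
    rw [map_zero]
    exact closure_minimal hF (isClosed_eval_eq_zero he F) (h x)
  · by_contra hx
    obtain ⟨F, hxF, hF⟩ := exists_eval_ne_zero_of_mem_isOpen he isClosed_closure.isOpen_compl hx
    refine hxF ?_
    rw [h F fun y hy => ?_, map_zero]
    by_contra hy'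
    exact hF y hy' (subset_closure hy)

lemma topologicalKrullDim_add_one_le_of_vanishing [Fintype σ]
    (he : IsInducing fun x => specPoint (e x)) {F : MvPolynomial σ ℂ} (hF : F ≠ 0) (h : ∀ x, eval (e x) F = 0) :
    topologicalKrullDim X + 1 ≤ Fintype.card σ := by
  have hI : ∀ G ∈ Ideal.span {F}, ∀ x, eval (e x) G = 0 := by
    intro G hG x
    obtain ⟨H, rfl⟩ := Ideal.mem_span_singleton'.1 hG
    rw [map_mul, h, mul_zero]
  calc topologicalKrullDim X + 1
      ≤ ringKrullDim (MvPolynomial σ ℂ ⧸ Ideal.span {F}) + 1 := by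
        gcongr; exact topologicalKrullDim_le_of_vanishing he _ hI
    _ ≤ ringKrullDim (MvPolynomial σ ℂ) :=
        ringKrullDim_quotient_succ_le_of_nonZeroDivisor (mem_nonZeroDivisors_of_ne_zero hF)
    _ = Fintype.card σ := by simp

end Inducing

section Quiver

variable {s t : A → V} {d : V → ℕ}

/-- The matrix entries of a representation. -/
def coord (s t : A → V) (d : V → ℕ) (N : QRep s t d) :
    (Σ a : A, Fin (d (t a)) × Fin (d (s a))) → ℂ :=
  fun x => N x.1 x.2.1 x.2.2

lemma coord_bijective : Function.Bijective (coord s t d) :=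
  ⟨fun M N h => by
    funext a; ext i j; exact congrFun h ⟨a, i, j⟩,
  fun c => ⟨fun a => Matrix.of fun i j => c ⟨a, i, j⟩, rfl⟩⟩

lemma isInducing_coord :
    @IsInducing _ _ (zarRep s t d) _ fun N : QRep s t d => specPoint (coord s t d N) := by
  let _ := zarRep s t d
  exact ⟨induced_compose⟩

lemma isInducing_coord_orbit (M : QRep s t d) :
    @IsInducing _ _ (TopologicalSpace.induced Subtype.val (zarRep s t d)) _
      fun N : orbit s t M => specPoint (coord s t d N.1) := by
  let _ := zarRep s t d
  exact isInducing_coord.comp IsInducing.subtypeVal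

/-- The family of square matrices `u₀ + ∑ xⱼ uⱼ`. -/
def affineMat {τ : Type} [Fintype τ] (u₀ : ∀ i : V, Matrix (Fin (d i)) (Fin (d i)) ℂ)
    (u : τ → ∀ i : V, Matrix (Fin (d i)) (Fin (d i)) ℂ) (x : τ → ℂ) :
    ∀ i : V, Matrix (Fin (d i)) (Fin (d i)) ℂ :=
  u₀ + ∑ j, x j • u j

section Family

variable {τ : Type} [Fintype τ] (u₀ : ∀ i : V, Matrix (Fin (d i)) (Fin (d i)) ℂ)
  (u : τ → ∀ i : V, Matrix (Fin (d i)) (Fin (d i)) ℂ)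

/-- The family `u₀ + ∑ xⱼ uⱼ` with indeterminate coefficients. -/
def genericMat (i : V) : Matrix (Fin (d i)) (Fin (d i)) (MvPolynomial τ ℂ) :=
  Matrix.of fun p q => C (u₀ i p q) + ∑ j, MvPolynomial.X j * C (u j i p q)

lemma genericMat_map_eval (x : τ → ℂ) (i : V) :
    (genericMat u₀ u i).map (eval x) = affineMat u₀ u x i := by
  ext p q
  simp [genericMat, affineMat, Matrix.sum_apply]

variable [Fintype V]

/-- The product of the determinants of the generic member of a family. -/
def genericDet : MvPolynomial τ ℂ := ∏ i, (genericMat u₀ u i).det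

lemma eval_genericDet (x : τ → ℂ) :
    eval x (genericDet u₀ u) = ∏ i, (affineMat u₀ u x i).det := by
  simp only [genericDet, map_prod, RingHom.map_det, RingHom.mapMatrix_apply, genericMat_map_eval]

lemma eval_genericDet_ne_zero_iff (x : τ → ℂ) :
    eval x (genericDet u₀ u) ≠ 0 ↔
      ∃ g : ∀ i : V, GL (Fin (d i)) ℂ, ∀ i, (g i : Matrix _ _ ℂ) = affineMat u₀ u x i := by
  rw [eval_genericDet, Finset.prod_ne_zero_iff]
  refine ⟨fun h => ⟨fun i => Matrix.GeneralLinearGroup.mkOfDetNeZero _ (h i (Finset.mem_univ i)),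
    fun i => rfl⟩, ?_⟩
  rintro ⟨g, hg⟩ i -
  rw [← hg]
  exact ((Matrix.isUnit_iff_isUnit_det _).1 (g i).isUnit).ne_zero

/-- The generic member of a family, as an invertible matrix of rational functions. -/
def genericGL (i : V) : GL (Fin (d i)) (Localization.Away (genericDet u₀ u)) :=
  Matrix.GeneralLinearGroup.mk'' ((genericMat u₀ u i).map (algebraMap _ _)) <| by
    have h : (genericMat u₀ u i).det ∣ genericDet u₀ u :=
      Finset.dvd_prod_of_mem (fun i => (genericMat u₀ u i).det) (Finset.mem_univ i)
    have := isUnit_of_dvd_unit (map_dvd (algebraMap _ (Localization.Away (genericDet u₀ u))) h)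
      (IsLocalization.Away.algebraMap_isUnit _)
    rwa [RingHom.map_det] at this

lemma genericGL_val (i : V) : (genericGL u₀ u i).1 = (genericMat u₀ u i).map (algebraMap _ _) :=
  rfl

/-- The translate of `M` by the generic member of a family. -/
def genericTranslate (M : QRep s t d) (a : A) :
    Matrix (Fin (d (t a))) (Fin (d (s a))) (Localization.Away (genericDet u₀ u)) :=
  (genericGL u₀ u (t a)).1 * (M a).map (algebraMap ℂ (Localization.Away (genericDet u₀ u))) *
    ((genericGL u₀ u (s a))⁻¹).1

/-- A polynomial on the representation variety, pulled back along `x ↦ (u₀ + ∑ xⱼ uⱼ) · M`. -/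
def pullback (M : QRep s t d) :
    MvPolynomial (Σ a : A, Fin (d (t a)) × Fin (d (s a))) ℂ →ₐ[ℂ]
      Localization.Away (genericDet u₀ u) :=
  aeval fun x => genericTranslate u₀ u M x.1 x.2.1 x.2.2

lemma evalAway_pullback (M : QRep s t d) {x : τ → ℂ} (hx : eval x (genericDet u₀ u) ≠ 0)
    {g : ∀ i : V, GL (Fin (d i)) ℂ} (hg : ∀ i, (g i : Matrix _ _ ℂ) = affineMat u₀ u x i)
    (F : MvPolynomial (Σ a : A, Fin (d (t a)) × Fin (d (s a))) ℂ) :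
    evalAway _ ⟨x, hx⟩ (pullback u₀ u M F) = eval (coord s t d (act s t g M)) F := by
  have hgen : ∀ i, Matrix.GeneralLinearGroup.map (evalAway _ ⟨x, hx⟩) (genericGL u₀ u i) = g i := by
    intro i
    apply Units.ext
    rw [hg, ← genericMat_map_eval]
    ext p q
    simp [Matrix.GeneralLinearGroup.map, genericGL_val]
  have hM : ∀ a, ((M a).map (algebraMap ℂ (Localization.Away (genericDet u₀ u)))).map
      (evalAway _ ⟨x, hx⟩) = M a := by
    intro a
    ext p q
    simp [IsScalarTower.algebraMap_apply ℂ (MvPolynomial τ ℂ)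
      (Localization.Away (genericDet u₀ u))]
  refine evalAway_aeval _ _ _ (fun ⟨a, p, q⟩ => ?_) F
  have : (genericTranslate u₀ u M a).map (evalAway _ ⟨x, hx⟩) = act s t g M a := by
    rw [genericTranslate, Matrix.map_mul, Matrix.map_mul, hM, act, ← hgen, ← hgen, ← map_inv]
    rfl
  exact congrFun (congrFun this p) q

/-- The translates of `M` by the invertible members of the family `u₀ + ∑ xⱼ uⱼ`. -/
def familyOrbit (M : QRep s t d) : Set (orbit s t M) :=
  {N | ∃ (x : τ → ℂ) (g : ∀ i : V, GL (Fin (d i)) ℂ),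
    (∀ i, (g i : Matrix _ _ ℂ) = affineMat u₀ u x i) ∧ N.1 = act s t g M}

lemma isIrreducible_familyOrbit (M : QRep s t d) (h : ∃ x, eval x (genericDet u₀ u) ≠ 0) :
    @IsIrreducible _ (TopologicalSpace.induced Subtype.val (zarRep s t d))
      (familyOrbit u₀ u M) := by
  let _ := zarRep s t d
  choose g hg using fun x : {x : τ → ℂ // eval x (genericDet u₀ u) ≠ 0} =>
    (eval_genericDet_ne_zero_iff u₀ u x.1).1 x.2
  convert isIrreducible_range_of_rational (isInducing_coord_orbit M) (pullback u₀ u M)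
    (fun x => ⟨act s t (g x) M, g x, rfl⟩)
    (fun x F => evalAway_pullback u₀ u M x.2 (hg x) F) h
  ext N
  refine ⟨?_, ?_⟩
  · rintro ⟨x, g', hg', hN⟩
    have hx := (eval_genericDet_ne_zero_iff u₀ u x).2 ⟨g', hg'⟩
    have : g ⟨x, hx⟩ = g' := by
      funext i
      exact Units.ext ((hg _ i).trans (hg' i).symm)
    exact ⟨⟨x, hx⟩, Subtype.ext ((congrArg (act s t · M) this).trans hN.symm)⟩
  · rintro ⟨x, rfl⟩
    exact ⟨x.1, g x, hg x, rfl⟩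

end Family

lemma isIrreducible_orbit [Fintype V] (M : QRep s t d) :
    @IsIrreducible _ (TopologicalSpace.induced Subtype.val (zarRep s t d))
      (Set.univ : Set (orbit s t M)) := by
  let b := Module.finBasis ℂ (∀ i : V, Matrix (Fin (d i)) (Fin (d i)) ℂ)
  have hb : ∀ f, affineMat 0 b (b.repr f) = f := fun f => by
    rw [affineMat, zero_add, b.sum_repr]
  convert isIrreducible_familyOrbit 0 b M ⟨b.repr 1, ?_⟩
  · refine (Set.eq_univ_of_forall fun N => ?_).symm
    obtain ⟨N, g, rfl⟩ := N
    exact ⟨b.repr fun i => (g i).1, g, fun i => by rw [hb], rfl⟩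
  · rw [eval_genericDet, hb]
    simp

lemma exists_eval_coord_eq_linear [Fintype A] (l : QRep s t d →ₗ[ℂ] ℂ) :
    ∃ F, ∀ N, eval (coord s t d N) F = l N := by
  classical
  let c : QRep s t d →ₗ[ℂ] _ := ⟨⟨coord s t d, fun _ _ => rfl⟩, fun _ _ => rfl⟩
  let E := LinearEquiv.ofBijective c coord_bijective
  refine ⟨∑ i, MvPolynomial.X i * C (l (E.symm (Pi.single i 1))), fun N => ?_⟩
  have h := (l ∘ₗ E.symm.toLinearMap).pi_apply_eq_sum_univ (E N)
  simp only [LinearMap.comp_apply, LinearEquiv.coe_coe, LinearEquiv.symm_apply_apply] at h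
  rw [h, map_sum]
  refine Finset.sum_congr rfl fun i _ => ?_
  rw [map_mul, eval_X, eval_C, smul_eq_mul]
  congr 3
  ext j
  simp [Pi.single_apply, eq_comm]

lemma exists_eval_coord_eq_phi [Fintype A] (M : QRep s t d) (l : QRep s t d →ₗ[ℂ] ℂ)
    (f : ∀ i : V, Matrix (Fin (d i)) (Fin (d i)) ℂ) :
    ∃ F, ∀ N, eval (coord s t d N) F = l (PhiL s t M N f) := by
  let m : QRep s t d →ₗ[ℂ] QRep s t d :=
    { toFun := fun N a => N a * f (s a)
      map_add' := fun N N' => by funext a; exact Matrix.add_mul _ _ _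
      map_smul' := fun c N => by funext a; exact Matrix.smul_mul c (N a) (f (s a)) }
  obtain ⟨F, hF⟩ := exists_eval_coord_eq_linear (l ∘ₗ m)
  refine ⟨F - C (l fun a => f (t a) * M a), fun N => ?_⟩
  rw [map_sub, hF, eval_C, LinearMap.comp_apply, ← map_sub]
  rfl

/-- Near `N = M`, the space of intertwiners `M → N` meets the affine slice `1 + ⟨u₁, …, uᵣ⟩` in a
single point, whose coordinates are the rational functions `Pⱼ / Δ` of `N`. -/
lemma exists_slice [Fintype V] [Fintype A] (M : QRep s t d) {r : ℕ}
    (hr : Module.finrank ℂ (LinearMap.range (PhiL s t M M)) = r) :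
    ∃ (u : Fin r → ∀ i : V, Matrix (Fin (d i)) (Fin (d i)) ℂ)
      (Δ : MvPolynomial (Σ a : A, Fin (d (t a)) × Fin (d (s a))) ℂ)
      (P : Fin r → MvPolynomial (Σ a : A, Fin (d (t a)) × Fin (d (s a))) ℂ),
      eval (coord s t d M) Δ ≠ 0 ∧
      (∀ N x, PhiL s t M N (affineMat 1 u x) = 0 →
        ∀ j, eval (coord s t d N) (P j) = eval (coord s t d N) Δ * x j) ∧
      ∀ N, eval (coord s t d N) Δ ≠ 0 →
        Module.finrank ℂ (LinearMap.ker (PhiL s t M M)) ≤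
          Module.finrank ℂ (LinearMap.ker (PhiL s t M N)) →
        ∃ x, PhiL s t M N (affineMat 1 u x) = 0 := by
  obtain ⟨L, hL⟩ := Submodule.exists_isCompl (LinearMap.ker (PhiL s t M M))
  have hdim := LinearMap.finrank_range_add_finrank_ker (PhiL s t M M)
  have hdimL := Submodule.finrank_add_eq_of_isCompl hL
  have hLr : Module.finrank ℂ L = r := by lia
  let b := Module.finBasisOfFinrankEq ℂ L hLr
  let u : Fin r → ∀ i : V, Matrix (Fin (d i)) (Fin (d i)) ℂ := fun j => (b j).1
  have hu : ∀ x : Fin r → ℂ, ∑ j, x j • u j = (b.equivFun.symm x : L).1 := by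
    intro x
    simp [u, Module.Basis.equivFun_symm_apply]
  let Λ : (Fin r → ℂ) →ₗ[ℂ] QRep s t d :=
    PhiL s t M M ∘ₗ L.subtype ∘ₗ b.equivFun.symm.toLinearMap
  have hΛ : LinearMap.ker Λ = ⊥ := by
    rw [LinearMap.ker_eq_bot']
    intro x hx
    have h0 : (b.equivFun.symm x : L).1 ∈ LinearMap.ker (PhiL s t M M) ⊓ L :=
      ⟨hx, (b.equivFun.symm x).2⟩
    rw [hL.inf_eq_bot, Submodule.mem_bot, Submodule.coe_eq_zero] at h0
    exact b.equivFun.symm.map_eq_zero_iff.1 h0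
  obtain ⟨β, hβ⟩ := Λ.exists_leftInverse_of_injective hΛ
  choose G hG using fun (p q : Fin r) =>
    exists_eval_coord_eq_phi M (LinearMap.proj p ∘ₗ β) (u q)
  choose B hB using fun p : Fin r => exists_eval_coord_eq_phi M (LinearMap.proj p ∘ₗ β) 1
  let GN : QRep s t d → Matrix (Fin r) (Fin r) ℂ := fun N =>
    (Matrix.of G).map (eval (coord s t d N))
  have hGN : ∀ N x, GN N *ᵥ x = β (PhiL s t M N (∑ j, x j • u j)) := by
    intro N x
    ext p
    simp [GN, Matrix.mulVec, dotProduct, hG, mul_comm]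
  have hdet : ∀ N, eval (coord s t d N) (Matrix.of G).det = (GN N).det := fun N => by
    rw [RingHom.map_det]; rfl
  refine ⟨u, (Matrix.of G).det, -((Matrix.of G).adjugate *ᵥ B), ?_, ?_, ?_⟩
  · have : GN M = 1 := by
      refine Matrix.ext_of_mulVec_single fun i => ?_
      rw [hGN, hu, Matrix.one_mulVec]
      exact LinearMap.congr_fun hβ _
    rw [hdet, this]
    simp
  · intro N x hx j
    have h1 : GN N *ᵥ x = -fun p => eval (coord s t d N) (B p) := by
      rw [hGN, eq_neg_iff_add_eq_zero, add_comm]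
      have : (fun p => eval (coord s t d N) (B p)) = β (PhiL s t M N 1) := by
        ext p; simp [hB]
      rw [this, ← map_add, ← map_add]
      exact (congrArg β hx).trans (map_zero β)
    have h2 := congrArg ((GN N).adjugate *ᵥ ·) h1
    simp only [Matrix.mulVec_mulVec, Matrix.adjugate_mul, Matrix.mulVec_neg,
      Matrix.smul_mulVec, Matrix.one_mulVec] at h2
    have h3 := congrFun h2 j
    rw [Pi.smul_apply, smul_eq_mul, ← hdet] at h3
    rw [h3, Pi.neg_apply, map_neg, Pi.neg_apply, RingHom.map_mulVec, ← RingHom.mapMatrix_apply,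
      RingHom.map_adjugate]
    rfl
  · intro N hN hker
    rw [hdet] at hN
    have hdisj : Disjoint (LinearMap.ker (PhiL s t M N)) L := by
      rw [Submodule.disjoint_def]
      intro f hf hfL
      have h1 : GN N *ᵥ b.equivFun ⟨f, hfL⟩ = 0 := by
        rw [hGN, hu, LinearEquiv.symm_apply_apply]
        exact (congrArg β hf).trans (map_zero β)
      have := Matrix.eq_zero_of_mulVec_eq_zero hN h1
      simpa using this
    have htop := Submodule.eq_top_of_disjoint _ _ (by lia) hdisj
    obtain ⟨κ, hκ, ℓ, hℓ, h⟩ := Submodule.mem_sup.1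
      (htop ▸ Submodule.mem_top : (1 : ∀ i : V, Matrix (Fin (d i)) (Fin (d i)) ℂ) ∈ _)
    refine ⟨b.equivFun (-⟨ℓ, hℓ⟩), ?_⟩
    rw [affineMat, hu, LinearEquiv.symm_apply_apply, ← h]
    simpa using hκ

lemma phiL_act (M : QRep s t d) (g : ∀ i : V, GL (Fin (d i)) ℂ)
    (f : ∀ i : V, Matrix (Fin (d i)) (Fin (d i)) ℂ) :
    PhiL s t M (act s t g M) (fun i => (g i).1 * f i) =
      fun a => (g (t a)).1 * PhiL s t M M f a := by
  funext a
  change act s t g M a * ((g (s a)).1 * f (s a)) - (g (t a)).1 * f (t a) * M a =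
    (g (t a)).1 * (M a * f (s a) - f (t a) * M a)
  have h : ((g (s a))⁻¹).1 * (g (s a)).1 = 1 := (g (s a)).inv_mul
  rw [act, Matrix.mul_sub, Matrix.mul_assoc, ← Matrix.mul_assoc _ _ (f (s a)), h,
    Matrix.one_mul, Matrix.mul_assoc, Matrix.mul_assoc]

lemma eq_act_iff_phiL_eq_zero (M N : QRep s t d) (g : ∀ i : V, GL (Fin (d i)) ℂ) :
    N = act s t g M ↔ PhiL s t M N (fun i => g i) = 0 := by
  have h : ∀ i, ((g i)⁻¹).1 * (g i).1 = 1 := fun i => (g i).inv_mul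
  have h' : ∀ i, (g i).1 * ((g i)⁻¹).1 = 1 := fun i => (g i).mul_inv
  constructor
  · rintro rfl
    funext a
    change (g (t a)).1 * M a * ((g (s a))⁻¹).1 * (g (s a)).1 - (g (t a)).1 * M a = 0
    rw [Matrix.mul_assoc, h, Matrix.mul_one, sub_self]
  · intro hN
    funext a
    have : N a * (g (s a)).1 = (g (t a)).1 * M a := sub_eq_zero.1 (congrFun hN a)
    rw [act, ← this, Matrix.mul_assoc, h', Matrix.mul_one]

lemma finrank_ker_phiL_le_act [Fintype V] (M : QRep s t d) (g : ∀ i : V, GL (Fin (d i)) ℂ) :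
    Module.finrank ℂ (LinearMap.ker (PhiL s t M M)) ≤
      Module.finrank ℂ (LinearMap.ker (PhiL s t M (act s t g M))) := by
  let m : (∀ i : V, Matrix (Fin (d i)) (Fin (d i)) ℂ) →ₗ[ℂ]
      (∀ i : V, Matrix (Fin (d i)) (Fin (d i)) ℂ) :=
    { toFun := fun f i => (g i).1 * f i
      map_add' := fun f f' => by funext i; exact Matrix.mul_add _ _ _
      map_smul' := fun c f => by funext i; exact Matrix.mul_smul (g i).1 c (f i) }
  have hm : ∀ f ∈ LinearMap.ker (PhiL s t M M), m f ∈ LinearMap.ker (PhiL s t M (act s t g M)) := by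
    intro f hf
    rw [LinearMap.mem_ker] at hf ⊢
    refine (phiL_act M g f).trans ?_
    funext a
    rw [hf]
    exact Matrix.mul_zero _
  refine LinearMap.finrank_le_finrank_of_injective (f := m.restrict hm) fun f f' h => ?_
  ext i : 2
  have h1 : (g i).1 * f.1 i = (g i).1 * f'.1 i := congrFun (congrArg Subtype.val h) i
  have h2 := congrArg (((g i)⁻¹).1 * ·) h1
  have h3 : ((g i)⁻¹).1 * (g i).1 = 1 := (g i).inv_mul
  simpa only [← Matrix.mul_assoc, h3, Matrix.one_mul] using h2

lemma affineMat_zero {τ : Type} [Fintype τ] (u₀ : ∀ i : V, Matrix (Fin (d i)) (Fin (d i)) ℂ)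
    (u : τ → ∀ i : V, Matrix (Fin (d i)) (Fin (d i)) ℂ) : affineMat u₀ u 0 = u₀ := by
  simp [affineMat]

lemma phiL_self_one (M : QRep s t d) : PhiL s t M M 1 = 0 := by
  funext a
  exact sub_eq_zero.2 ((Matrix.mul_one (M a)).trans (Matrix.one_mul (M a)).symm)

section Slice

variable [Fintype V] {r : ℕ}

lemma eval_genericDet_one_zero (u : Fin r → ∀ i : V, Matrix (Fin (d i)) (Fin (d i)) ℂ) :
    eval 0 (genericDet 1 u) ≠ 0 := by
  rw [eval_genericDet_ne_zero_iff, affineMat_zero]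
  exact ⟨1, fun i => rfl⟩

lemma genericDet_one_ne_zero (u : Fin r → ∀ i : V, Matrix (Fin (d i)) (Fin (d i)) ℂ) :
    genericDet 1 u ≠ 0 := fun h =>
  eval_genericDet_one_zero u (by rw [h, map_zero])

variable {M : QRep s t d} {u : Fin r → ∀ i : V, Matrix (Fin (d i)) (Fin (d i)) ℂ}
  {Δ : MvPolynomial (Σ a : A, Fin (d (t a)) × Fin (d (s a))) ℂ}
  {P : Fin r → MvPolynomial (Σ a : A, Fin (d (t a)) × Fin (d (s a))) ℂ}

/-- The slice meets every orbit in a dense subset, so that an equation which holds on the translates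
of `M` by the slice holds on the orbit. -/
lemma eval_eq_zero_of_pullback_eq_zero (hΔ : eval (coord s t d M) Δ ≠ 0)
    (hP : ∀ N x, PhiL s t M N (affineMat 1 u x) = 0 →
      ∀ j, eval (coord s t d N) (P j) = eval (coord s t d N) Δ * x j)
    (hx : ∀ N, eval (coord s t d N) Δ ≠ 0 →
      Module.finrank ℂ (LinearMap.ker (PhiL s t M M)) ≤
        Module.finrank ℂ (LinearMap.ker (PhiL s t M N)) →
      ∃ x, PhiL s t M N (affineMat 1 u x) = 0)
    {F : MvPolynomial (Σ a : A, Fin (d (t a)) × Fin (d (s a))) ℂ} (hF : pullback 1 u M F = 0)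
    (N : orbit s t M) : eval (coord s t d N.1) F = 0 := by
  let _ := zarRep s t d
  let T : ∀ i, Matrix (Fin (d i)) (Fin (d i))
      (MvPolynomial (Σ a : A, Fin (d (t a)) × Fin (d (s a))) ℂ) := fun i =>
    Matrix.of fun p q => Δ * C ((1 : Matrix _ _ ℂ) p q) + ∑ j, P j * C (u j i p q)
  have hT : ∀ N x, PhiL s t M N (affineMat 1 u x) = 0 → ∀ i,
      eval (coord s t d N) (T i).det =
        eval (coord s t d N) Δ ^ d i * (affineMat 1 u x i).det := by
    intro N x h i
    have : (T i).map (eval (coord s t d N)) = eval (coord s t d N) Δ • affineMat 1 u x i := by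
      ext p q
      simp [T, affineMat, hP N x h, Matrix.sum_apply, mul_add, Finset.mul_sum, mul_assoc]
    rw [RingHom.map_det, RingHom.mapMatrix_apply, this, Matrix.det_smul, Fintype.card_fin]
  have hM : PhiL s t M M (affineMat 1 u 0) = 0 := by rw [affineMat_zero, phiL_self_one]
  let p := Δ * ∏ i, (T i).det
  have hp : eval (coord s t d M) p ≠ 0 := by
    rw [map_mul, map_prod]
    refine mul_ne_zero hΔ (Finset.prod_ne_zero_iff.2 fun i _ => ?_)
    rw [hT M 0 hM, affineMat_zero]
    simp [hΔ]
  by_contra hN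
  have hopen := isOpen_eval_ne_zero (isInducing_coord_orbit M)
  obtain ⟨N', -, hN'F, hN'p⟩ := (isIrreducible_orbit M).2 _ _ (hopen F) (hopen p)
    ⟨N, trivial, hN⟩ ⟨⟨M, 1, by funext a; simp [act]⟩, trivial, hp⟩
  obtain ⟨N', g, rfl⟩ := N'
  change eval _ p ≠ 0 at hN'p
  rw [map_mul, map_prod] at hN'p
  have hΔ' := left_ne_zero_of_mul hN'p
  obtain ⟨x, hx⟩ := hx _ hΔ' (finrank_ker_phiL_le_act M g)
  have hD : eval x (genericDet 1 u) ≠ 0 := by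
    rw [eval_genericDet]
    refine Finset.prod_ne_zero_iff.2 fun i hi => ?_
    have := Finset.prod_ne_zero_iff.1 (right_ne_zero_of_mul hN'p) i hi
    rw [hT _ x hx] at this
    exact right_ne_zero_of_mul this
  obtain ⟨g', hg'⟩ := (eval_genericDet_ne_zero_iff _ _ _).1 hD
  refine hN'F ?_
  have hact : act s t g M = act s t g' M := by
    rw [eq_act_iff_phiL_eq_zero, funext hg']
    exact hx
  change eval (coord s t d (act s t g M)) F = 0
  rw [hact, ← evalAway_pullback 1 u M hD hg', hF, map_zero]

lemma le_topologicalKrullDim_orbit (hΔ : eval (coord s t d M) Δ ≠ 0)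
    (hP : ∀ N x, PhiL s t M N (affineMat 1 u x) = 0 →
      ∀ j, eval (coord s t d N) (P j) = eval (coord s t d N) Δ * x j) :
    (r : WithBot ℕ∞) ≤ @topologicalKrullDim (orbit s t M)
      (TopologicalSpace.induced Subtype.val (zarRep s t d)) := by
  let _ := zarRep s t d
  let v : ℕ → Fin r → ∀ i : V, Matrix (Fin (d i)) (Fin (d i)) ℂ :=
    fun k j => if j.1 < k then u j else 0
  have hv : ∀ k x, affineMat 1 (v k) x = affineMat 1 u fun j => if j.1 < k then x j else 0 := by
    intro k x
    simp [affineMat, v, ite_smul, smul_ite]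
  have hphi : ∀ k x g, (∀ i, (g i : Matrix _ _ ℂ) = affineMat 1 (v k) x i) →
      PhiL s t M (act s t g M) (affineMat 1 u fun j => if j.1 < k then x j else 0) = 0 := by
    intro k x g hg
    rw [← hv, ← funext hg]
    exact (eq_act_iff_phiL_eq_zero M _ g).1 rfl
  refine le_topologicalKrullDim_of_chain (isInducing_coord_orbit M)
    (fun k => familyOrbit 1 (v k) M)
    (fun k _ => isIrreducible_familyOrbit 1 (v k) M ⟨0, eval_genericDet_one_zero _⟩) ?_ ?_
  · rintro k - N ⟨x, g, hg, hN⟩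
    refine ⟨fun j => if j.1 < k then x j else 0, g, fun i => ?_, hN⟩
    rw [hg, hv, hv]
    congr 2
    funext j
    split_ifs <;> first | rfl | lia
  · intro k hk
    refine ⟨P ⟨k, hk⟩, ?_, ?_⟩
    · rintro ⟨N, hN'⟩ ⟨x, g, hg, hN⟩
      change N = _ at hN
      subst hN
      rw [hP _ _ (hphi k x g hg)]
      simp
    · have hb : ∃ x, evalAway (genericDet 1 (v (k + 1))) x (pullback 1 (v (k + 1)) M Δ) ≠ 0 := by
        refine ⟨⟨0, eval_genericDet_one_zero _⟩, ?_⟩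
        rw [evalAway_pullback (g := 1) _ _ _ _ fun i => by rw [affineMat_zero]; rfl]
        have : act s t 1 M = M := by funext a; simp [act]
        rwa [this]
      obtain ⟨⟨x, hD⟩, hxΔ, hxk⟩ := exists_evalAway_ne_zero_and_eval_ne_zero hb
        (MvPolynomial.X_ne_zero (⟨k, hk⟩ : Fin r))
      obtain ⟨g, hg⟩ := (eval_genericDet_ne_zero_iff _ _ _).1 hD
      rw [evalAway_pullback _ _ _ hD hg] at hxΔ
      refine ⟨⟨act s t g M, g, rfl⟩, ⟨x, g, hg, rfl⟩, ?_⟩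
      rw [hP _ _ (hphi (k + 1) x g hg)]
      rw [eval_X] at hxk
      simpa using ⟨hxΔ, hxk⟩

end Slice

lemma topologicalKrullDim_orbit [Fintype V] [Fintype A] (M : QRep s t d) :
    @topologicalKrullDim (orbit s t M) (TopologicalSpace.induced Subtype.val (zarRep s t d)) =
      (Module.finrank ℂ (LinearMap.range (PhiL s t M M)) : ℕ) := by
  obtain ⟨u, Δ, P, hΔ, hP, hx⟩ := exists_slice M rfl
  let _ := zarRep s t d
  exact le_antisymm
    (topologicalKrullDim_le_of_rational (isInducing_coord_orbit M) (genericDet_one_ne_zero u)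
      (pullback 1 u M) fun F hF => eval_eq_zero_of_pullback_eq_zero hΔ hP hx hF)
    (le_topologicalKrullDim_orbit hΔ hP)

lemma topologicalKrullDim_qRep [Fintype A] :
    @topologicalKrullDim (QRep s t d) (zarRep s t d) = (Module.finrank ℂ (QRep s t d) : ℕ) := by
  let _ := zarRep s t d
  rw [topologicalKrullDim_eq_card isInducing_coord coord_bijective]
  simp [Module.finrank_pi_fintype, Module.finrank_matrix, Fintype.card_sigma]

lemma topologicalKrullDim_qRep_le_of_dense [Fintype V] [Fintype A] (M : QRep s t d)
    (h : @Dense _ (zarRep s t d) (orbit s t M)) :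
    @topologicalKrullDim (QRep s t d) (zarRep s t d) ≤
      (Module.finrank ℂ (LinearMap.range (PhiL s t M M)) : ℕ) := by
  obtain ⟨u, Δ, P, hΔ, hP, hx⟩ := exists_slice M rfl
  let _ := zarRep s t d
  refine topologicalKrullDim_le_of_rational isInducing_coord (genericDet_one_ne_zero u)
    (pullback 1 u M) fun F hF N => ?_
  rw [(dense_iff_forall_eval_eq_zero isInducing_coord coord_bijective.2 _).1 h F fun N hN =>
    eval_eq_zero_of_pullback_eq_zero hΔ hP hx hF ⟨N, hN⟩, map_zero]

lemma dense_orbit_of_topologicalKrullDim_eq [Fintype A] (M : QRep s t d)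
    (h : @topologicalKrullDim (orbit s t M)
      (TopologicalSpace.induced Subtype.val (zarRep s t d)) = (Module.finrank ℂ (QRep s t d) : ℕ)) :
    @Dense _ (zarRep s t d) (orbit s t M) := by
  let _ := zarRep s t d
  rw [dense_iff_forall_eval_eq_zero isInducing_coord coord_bijective.2]
  intro F hF
  by_contra hF0
  have hlt := topologicalKrullDim_add_one_le_of_vanishing (isInducing_coord_orbit M) hF0
    fun N => hF N.1 N.2
  have hc := topologicalKrullDim_eq_card (isInducing_coord (s := s) (t := t) (d := d))
    coord_bijective
  rw [h, ← hc, topologicalKrullDim_qRep] at hlt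
  have : Module.finrank ℂ (QRep s t d) + 1 ≤ Module.finrank ℂ (QRep s t d) := by
    exact_mod_cast hlt
  lia

lemma rigid_iff [Fintype A] (M : QRep s t d) :
    Rigid s t M ↔
      Module.finrank ℂ (QRep s t d) ≤ Module.finrank ℂ (LinearMap.range (PhiL s t M M)) := by
  change Function.Surjective (PhiL s t M M) ↔ _
  rw [← LinearMap.range_eq_top]
  exact ⟨fun h => by rw [h, finrank_top], fun h =>
    Submodule.eq_top_of_finrank_eq ((Submodule.finrank_le _).antisymm h)⟩

end Quiver

/-- The orbit of `M` is dense iff `M` is rigid, and the codimension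
of the orbit equals `dim Ext¹(M,M)`. -/
theorem dense_orbit_iff_rigid [Fintype V] [Fintype A] (s t : A → V)
    (hQ : IsDynkin s t) (d : V → ℕ) (M : QRep s t d) :
    ((@Dense _ (zarRep s t d) (orbit s t M)) ↔ Rigid s t M) ∧
    @topologicalKrullDim (orbit s t M) (TopologicalSpace.induced Subtype.val (zarRep s t d)) +
        ((Module.finrank ℂ
            ((∀ a : A, Matrix (Fin (d (t a))) (Fin (d (s a))) ℂ) ⧸
              LinearMap.range (PhiL s t M M)) : ℕ∞) : WithBot ℕ∞) =
      @topologicalKrullDim (QRep s t d) (zarRep s t d) := by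
  refine ⟨⟨fun h => ?_, fun h => ?_⟩, ?_⟩
  · have := topologicalKrullDim_qRep_le_of_dense M h
    rw [topologicalKrullDim_qRep] at this
    exact (rigid_iff M).2 (by exact_mod_cast this)
  · apply dense_orbit_of_topologicalKrullDim_eq
    rw [topologicalKrullDim_orbit, ((rigid_iff M).1 h).antisymm (Submodule.finrank_le _)]
  · rw [topologicalKrullDim_orbit, topologicalKrullDim_qRep,
      ← Submodule.finrank_quotient_add_finrank (LinearMap.range (PhiL s t M M)), add_comm]
    norm_cast

end
end
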